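/- arXiv:0712.3902 — 4 statements merged into one kernel-verified Lean document; each statement's English description precedes it below -/
import Mathlib

section
/- Let α, β ∈ ℝ with α > -1, β > -1 and α + β ≠ -1, and let t, s ∈ ℝ. Then the series below converges absolutely and the addition theorem for confluent hypergeometric functions holds: ₁F₁(α+1; α+β+2; t+s) = Σ_{n=0}^∞ [(α+1)_n (β+1)_n (α+β+1)_n / ((α+β+1)_{2n} (α+β+2)_{2n})] · ((t s)^n / n!) · ₁F₁(α+n+1; α+β+2n+2; t) · ₁F₁(α+n+1; α+β+2n+2; s). -/
/-- The Pochhammer symbol `(a)_n = a(a+1)⋯(a+n-1)`. -/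
noncomputable def poch (a : ℝ) (n : ℕ) : ℝ := ∏ i ∈ Finset.range n, (a + i)

/-- The confluent hypergeometric function `₁F₁(a; c; z)`. -/
noncomputable def oneF1 (a c z : ℝ) : ℝ :=
  ∑' n : ℕ, poch a n * z ^ n / (poch c n * n.factorial)

lemma poch_succ (a : ℝ) (n : ℕ) : poch a (n + 1) = poch a n * (a + n) := by
  simp [poch, Finset.prod_range_succ]

lemma poch_zero (a : ℝ) : poch a 0 = 1 := by simp [poch]

lemma poch_pos {a : ℝ} (ha : 0 < a) (n : ℕ) : 0 < poch a n :=
  Finset.prod_pos fun i _ => by positivity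

lemma poch_add (a : ℝ) (m n : ℕ) : poch a (m + n) = poch a m * poch (a + m) n := by
  induction n with
  | zero => simp [poch_zero]
  | succ n ih => rw [← add_assoc, poch_succ, poch_succ, ih]; push_cast; ring

lemma poch_le {a c : ℝ} (ha : 0 < a) (hac : a ≤ c) (n : ℕ) : poch a n ≤ poch c n :=
  Finset.prod_le_prod (fun i _ => by positivity) fun i _ => by linarith

lemma poch_ne {c : ℝ} (hc : 0 < c) (hc1 : c ≠ 1) (n : ℕ) : poch (c - 1) n ≠ 0 := by
  refine Finset.prod_ne_zero_iff.mpr fun i _ => ?_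
  rcases Nat.eq_zero_or_pos i with rfl | h
  · simpa [sub_eq_zero] using hc1
  · have : (1 : ℝ) ≤ i := by exact_mod_cast h
    have : 0 < c - 1 + i := by linarith
    exact this.ne'

noncomputable def vv (c : ℝ) (n : ℕ) : ℝ := poch (c - 1) n / poch (c - 1) (2 * n)

noncomputable def ww (a b c : ℝ) (n : ℕ) : ℝ :=
  n.factorial * poch b n * poch c (2 * n) / poch a n * vv c n

noncomputable def AA (a c x : ℝ) (n j : ℕ) : ℝ :=
  poch a j * (j.choose n : ℝ) * x ^ j / (poch c (n + j) * j.factorial)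

noncomputable def TT (a b c : ℝ) (j k n : ℕ) : ℝ :=
  ww a b c n * (poch a j * (j.choose n : ℝ) / poch c (n + j)) *
    (poch a k * (k.choose n : ℝ) / poch c (n + k))

lemma lin_ne {c : ℝ} (hc : 0 < c) (hc1 : c ≠ 1) (n : ℕ) : c - 1 + 2 * n ≠ 0 := by
  rcases Nat.eq_zero_or_pos n with rfl | h
  · simpa [sub_eq_zero] using hc1
  · have : (1 : ℝ) ≤ n := by exact_mod_cast h
    have : 0 < c - 1 + 2 * n := by linarith
    exact this.ne'

lemma vv_succ {c : ℝ} (hc : 0 < c) (hc1 : c ≠ 1) (n : ℕ) :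
    vv c (n + 1) = vv c n * ((c - 1 + n) / ((c - 1 + 2 * n) * (c + 2 * n))) := by
  have h1 := poch_ne hc hc1 (2 * n)
  have h2 := lin_ne hc hc1 n
  have h3 : c + 2 * n ≠ 0 := by positivity
  unfold vv
  rw [show 2 * (n + 1) = 2 * n + 1 + 1 by ring, poch_succ, poch_succ, poch_succ]
  push_cast
  rw [show c - 1 + (2 * (n : ℝ) + 1) = c + 2 * n by ring]
  field_simp

lemma vv_pos {c : ℝ} (hc : 0 < c) (hc1 : c ≠ 1) (n : ℕ) : 0 < vv c n := by
  induction n with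
  | zero => simp [vv, poch_zero]
  | succ n ih =>
    rw [vv_succ hc hc1]
    refine mul_pos ih ?_
    rcases Nat.eq_zero_or_pos n with rfl | h
    · have : c - 1 ≠ 0 := sub_ne_zero.mpr hc1
      have e : (c - 1 + (0 : ℕ)) / ((c - 1 + 2 * (0 : ℕ)) * (c + 2 * (0 : ℕ))) = 1 / c := by
        simp; field_simp
      rw [e]; positivity
    · have : (1 : ℝ) ≤ n := by exact_mod_cast h
      have h1 : 0 < c - 1 + n := by linarith
      have h2 : 0 < c - 1 + 2 * n := by linarith
      positivity

lemma ww_pos {a b c : ℝ} (ha : 0 < a) (hb : 0 < b) (hc : 0 < c) (hc1 : c ≠ 1) (n : ℕ) :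
    0 < ww a b c n := by
  have := poch_pos ha n
  have := poch_pos hb n
  have := poch_pos hc (2 * n)
  have := vv_pos hc hc1 n
  unfold ww
  positivity

lemma ww_succ {a b c : ℝ} (ha : 0 < a) (hc : 0 < c) (hc1 : c ≠ 1) (n : ℕ) :
    ww a b c (n + 1) = ww a b c n *
      ((n + 1) * (b + n) * (c + 2 * n + 1) * (c - 1 + n) / ((a + n) * (c - 1 + 2 * n))) := by
  have h1 := (poch_pos ha n).ne'
  have h2 := lin_ne hc hc1 n
  have h3 : c + 2 * n ≠ 0 := by positivity
  have h4 : a + n ≠ 0 := by positivity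
  unfold ww
  rw [vv_succ hc hc1, show 2 * (n + 1) = 2 * n + 1 + 1 by ring, poch_succ c, poch_succ c,
    poch_succ, poch_succ, Nat.factorial_succ]
  push_cast
  field_simp
  ring

lemma choose_r (k n : ℕ) : (k.choose (n + 1) : ℝ) = k.choose n * ((k - n) / (n + 1)) := by
  have h : (n + 1 : ℝ) ≠ 0 := by positivity
  rw [mul_div_assoc', eq_div_iff h]
  rcases le_or_gt n k with hk | hk
  · have := Nat.choose_succ_right_eq k n
    rw [← Nat.cast_sub hk]
    exact_mod_cast this
  · rw [Nat.choose_eq_zero_of_lt hk, Nat.choose_eq_zero_of_lt (by omega)]; simp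

lemma choose_s (k n : ℕ) :
    ((k + 1).choose (n + 1) : ℝ) = k.choose n * ((k + 1) / (n + 1)) := by
  have h : (n + 1 : ℝ) ≠ 0 := by positivity
  rw [mul_div_assoc', eq_div_iff h]
  have := Nat.add_one_mul_choose_eq k n
  rw [mul_comm ((k.choose n : ℝ))]
  exact_mod_cast this.symm

set_option maxHeartbeats 2000000 in
lemma TT_r {a b c : ℝ} (ha : 0 < a) (hc : 0 < c) (hc1 : c ≠ 1) (j k n : ℕ) :
    TT a b c j k (n + 1) = TT a b c j k n *
      ((j - n) * (k - n) * (b + n) * (c + 2 * n + 1) * (c - 1 + n) /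
        ((n + 1) * (a + n) * (c - 1 + 2 * n) * (c + n + j) * (c + n + k))) := by
  have h2 := lin_ne hc hc1 n
  have h4 : a + n ≠ 0 := by positivity
  have h5 : c + n + j ≠ 0 := by positivity
  have h6 : c + n + k ≠ 0 := by positivity
  have h7 := (poch_pos hc (n + j)).ne'
  have h8 := (poch_pos hc (n + k)).ne'
  unfold TT
  rw [ww_succ ha hc hc1, choose_r, choose_r, show n + 1 + j = n + j + 1 by ring,
    show n + 1 + k = n + k + 1 by ring, poch_succ c, poch_succ c]
  push_cast
  rw [← add_assoc, ← add_assoc]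
  have h11 : (n + 1 : ℝ) ≠ 0 := by positivity
  generalize ww a b c n = W
  generalize poch c (n + j) = P1 at *
  generalize poch c (n + k) = P2 at *
  generalize poch a j = P3
  generalize poch a k = P4
  generalize (j.choose n : ℝ) = P5
  generalize (k.choose n : ℝ) = P6
  generalize c - 1 + 2 * (n : ℝ) = L1 at *
  generalize c + (n : ℝ) + j = L2 at *
  generalize c + (n : ℝ) + k = L3 at *
  generalize a + (n : ℝ) = L4 at *
  generalize (n : ℝ) + 1 = L5 at *
  generalize (c + 2 * (n : ℝ) + 1) = L6 at *
  generalize (c - 1 + (n : ℝ)) = L7 at *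
  field_simp

set_option maxHeartbeats 2000000 in
lemma TT_s {a b c : ℝ} (ha : 0 < a) (hc : 0 < c) (hc1 : c ≠ 1) (j k n : ℕ) :
    TT a b c j (k + 1) (n + 1) = TT a b c j k n *
      ((j - n) * (k + 1) * (b + n) * (c + 2 * n + 1) * (c - 1 + n) * (a + k) /
        ((n + 1) * (a + n) * (c - 1 + 2 * n) * (c + n + j) * (c + n + k) * (c + n + k + 1))) := by
  have h2 := lin_ne hc hc1 n
  have h4 : a + n ≠ 0 := by positivity
  have h5 : c + n + j ≠ 0 := by positivity
  have h6 : c + n + k ≠ 0 := by positivity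
  have h9 : c + n + k + 1 ≠ 0 := by positivity
  have h7 := (poch_pos hc (n + j)).ne'
  have h8 := (poch_pos hc (n + k)).ne'
  unfold TT
  rw [ww_succ ha hc hc1, choose_r, choose_s, show n + 1 + j = n + j + 1 by ring,
    show n + 1 + (k + 1) = n + k + 1 + 1 by ring, poch_succ c, poch_succ c, poch_succ c,
    poch_succ a]
  push_cast
  rw [show c + ((n : ℝ) + k + 1) = c + n + k + 1 by ring, ← add_assoc, ← add_assoc]
  have h11 : (n + 1 : ℝ) ≠ 0 := by positivity
  generalize ww a b c n = W
  generalize poch c (n + j) = P1 at *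
  generalize poch c (n + k) = P2 at *
  generalize poch a j = P3
  generalize poch a k = P4
  generalize (j.choose n : ℝ) = P5
  generalize (k.choose n : ℝ) = P6
  generalize c - 1 + 2 * (n : ℝ) = L1 at *
  generalize c + (n : ℝ) + j = L2 at *
  generalize c + (n : ℝ) + k + 1 = L8 at *
  generalize c + (n : ℝ) + k = L3 at *
  generalize a + (n : ℝ) = L4 at *
  generalize (n : ℝ) + 1 = L5 at *
  generalize (c + 2 * (n : ℝ) + 1) = L6 at *
  generalize (c - 1 + (n : ℝ)) = L7 at *
  field_simp

lemma TT_tele {a b c : ℝ} (ha : 0 < a) (hc : 0 < c) (hc1 : c ≠ 1) (habc : c = a + b)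
    (j k N : ℕ) :
    ∑ n ∈ Finset.range (N + 1),
      (TT a b c j (k + 1) n - (a + j + k) / (c + j + k) * TT a b c j k n) =
    - (TT a b c j k N * ((j - N) * (b + N) * (c - 1 + N) /
      ((c - 1 + 2 * N) * (c + N + k) * (c + j + k)))) := by
  have h9 : c + j + k ≠ 0 := by positivity
  induction N with
  | zero =>
    have h7 := (poch_pos hc j).ne'
    have h8 := (poch_pos hc k).ne'
    have h6 : c + k ≠ 0 := by positivity
    have h5 : c - 1 ≠ 0 := sub_ne_zero.mpr hc1
    simp only [zero_add, Finset.sum_range_one, TT, Nat.choose_zero_right, poch_succ]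
    push_cast
    simp only [mul_zero, add_zero, sub_zero]
    field_simp
    rw [habc]
    ring
  | succ n ih =>
    rw [Finset.sum_range_succ, ih, TT_s ha hc hc1, TT_r ha hc hc1 j k n]
    have h2 := lin_ne hc hc1 n
    have h3 := lin_ne hc hc1 (n + 1)
    have h4 : a + n ≠ 0 := by positivity
    have h5 : c + n + j ≠ 0 := by positivity
    have h6 : c + n + k ≠ 0 := by positivity
    have h10 : c + n + k + 1 ≠ 0 := by positivity
    have h11 : (n + 1 : ℝ) ≠ 0 := by positivity
    have h12 : c + 2 * n + 1 ≠ 0 := by positivity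
    push_cast
    rw [show c - 1 + 2 * ((n : ℝ) + 1) = c + 2 * n + 1 by ring,
      show c + ((n : ℝ) + 1) + k = c + n + k + 1 by ring]
    generalize TT a b c j k n = X
    have hb : b = c - a := by linarith
    subst hb
    field_simp
    ring

set_option maxHeartbeats 2000000 in
lemma TT_sum {a b c : ℝ} (ha : 0 < a) (hc : 0 < c) (hc1 : c ≠ 1) (habc : c = a + b)
    (j k N : ℕ) (h : k ≤ N) :
    ∑ n ∈ Finset.range (N + 1), TT a b c j k n = poch a (j + k) / poch c (j + k) := by
  induction k generalizing N with
  | zero =>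
    rw [Finset.sum_eq_single 0]
    · simp [TT, ww, vv, poch_zero]
    · intro n _ hn
      simp [TT, Nat.choose_eq_zero_of_lt (Nat.pos_of_ne_zero hn)]
    · simp
  | succ k ih =>
    have h1 := TT_tele ha hc hc1 habc j k N
    rw [Finset.sum_sub_distrib, ← Finset.mul_sum, ih N (by omega)] at h1
    have h0 : TT a b c j k N = 0 := by simp [TT, Nat.choose_eq_zero_of_lt (show k < N by omega)]
    rw [h0, zero_mul, neg_zero, sub_eq_zero] at h1
    have h9 : c + j + k ≠ 0 := by positivity
    have h7 := (poch_pos hc (j + k)).ne'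
    rw [h1, ← add_assoc, poch_succ, poch_succ]
    push_cast
    rw [← add_assoc, ← add_assoc]
    field_simp

noncomputable def SS (a c t s : ℝ) (p : ℕ × ℕ) : ℝ :=
  poch a (p.1 + p.2) / poch c (p.1 + p.2) * (t ^ p.1 / p.1.factorial * (s ^ p.2 / p.2.factorial))

noncomputable def HH (a b c t s : ℝ) (x : (ℕ × ℕ) × ℕ) : ℝ :=
  ww a b c x.2 * (AA a c t x.2 x.1.1 * AA a c s x.2 x.1.2)

lemma HH_hasSum {a b c : ℝ} (ha : 0 < a) (hc : 0 < c) (hc1 : c ≠ 1) (habc : c = a + b)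
    (t s : ℝ) (p : ℕ × ℕ) : HasSum (fun n => HH a b c t s (p, n)) (SS a c t s p) := by
  have e : ∀ n, HH a b c t s (p, n) =
      TT a b c p.1 p.2 n * (t ^ p.1 / p.1.factorial * (s ^ p.2 / p.2.factorial)) := by
    intro n
    simp only [HH, TT, AA]
    ring
  have : HasSum (fun n => TT a b c p.1 p.2 n) (∑ n ∈ Finset.range (p.2 + 1), TT a b c p.1 p.2 n) := by
    apply hasSum_sum_of_ne_finset_zero
    intro n hn
    simp only [Finset.mem_range, not_lt] at hn
    simp [TT, Nat.choose_eq_zero_of_lt (show p.2 < n by omega)]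
  rw [TT_sum ha hc hc1 habc _ _ _ le_rfl] at this
  simp_rw [e]
  exact this.mul_right _

lemma exp_summable (t s : ℝ) :
    Summable fun p : ℕ × ℕ => (|t| ^ p.1 / p.1.factorial * (|s| ^ p.2 / p.2.factorial)) :=
  (Real.summable_pow_div_factorial |t|).mul_of_nonneg (Real.summable_pow_div_factorial |s|)
    (fun n => by positivity) (fun n => by positivity)

lemma SS_summable {a c : ℝ} (ha : 0 < a) (hac : a ≤ c) (t s : ℝ) : Summable (SS a c t s) := by
  refine Summable.of_norm_bounded (exp_summable t s) fun p => ?_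
  have h1 := poch_pos ha (p.1 + p.2)
  have h2 := poch_pos (ha.trans_le hac) (p.1 + p.2)
  have h3 : poch a (p.1 + p.2) / poch c (p.1 + p.2) ≤ 1 :=
    (div_le_one h2).mpr (poch_le ha hac _)
  have h4 : 0 ≤ poch a (p.1 + p.2) / poch c (p.1 + p.2) := by positivity
  simp only [SS, norm_mul, norm_div, norm_pow, Real.norm_eq_abs, Nat.abs_cast]
  rw [← abs_div, abs_of_nonneg h4]
  exact mul_le_of_le_one_left (by positivity) h3

lemma HH_summable {a b c : ℝ} (ha : 0 < a) (hb : 0 < b) (hc : 0 < c) (hc1 : c ≠ 1)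
    (habc : c = a + b) (t s : ℝ) : Summable (HH a b c t s) := by
  have hn : ∀ x, ‖HH a b c t s x‖ = HH a b c |t| |s| x := by
    intro x
    have h1 := ww_pos ha hb hc hc1 x.2
    have h2 := fun n => poch_pos ha n
    have h3 := fun n => poch_pos hc n
    simp only [HH, AA, norm_mul, norm_div, norm_pow, Real.norm_eq_abs, Nat.abs_cast,
      abs_of_pos h1, abs_of_pos (h2 _), abs_of_pos (h3 _)]
  refine Summable.of_norm ?_
  rw [show (fun x => ‖HH a b c t s x‖) = HH a b c |t| |s| from funext hn]
  rw [summable_prod_of_nonneg (fun x => by rw [← hn]; exact norm_nonneg _)]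
  refine ⟨fun p => (HH_hasSum ha hc hc1 habc _ _ p).summable, ?_⟩
  simp_rw [(HH_hasSum ha hc hc1 habc _ _ _).tsum_eq]
  exact SS_summable ha (by linarith) _ _

lemma SS_tsum {a c : ℝ} (ha : 0 < a) (hac : a ≤ c) (t s : ℝ) :
    ∑' p, SS a c t s p = oneF1 a c (t + s) := by
  have h := (SS_summable ha hac t s)
  rw [← Finset.HasAntidiagonal.sigmaAntidiagonalEquivProd.tsum_eq (SS a c t s)]
  have h' := (Finset.HasAntidiagonal.sigmaAntidiagonalEquivProd.summable_iff (f := SS a c t s)).mpr h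
  simp only [Function.comp_def] at h'
  rw [Summable.tsum_sigma' (fun n => (hasSum_fintype _).summable) h', oneF1]
  congr 1; ext n
  rw [tsum_fintype, Finset.univ_eq_attach]
  simp only [Finset.HasAntidiagonal.sigmaAntidiagonalEquivProd_apply]
  rw [Finset.sum_attach (Finset.HasAntidiagonal.antidiagonal n) (fun p => SS a c t s p),
    (Commute.all t s).add_pow', Finset.mul_sum, Finset.sum_div]
  refine Finset.sum_congr rfl fun p hp => ?_
  have hp' := Finset.HasAntidiagonal.mem_antidiagonal.mp hp
  subst hp'
  have h2 := (poch_pos (ha.trans_le hac) (p.1 + p.2)).ne'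
  have h3 := Nat.add_choose_mul_factorial_mul_factorial p.1 p.2
  have h4 : ((p.1 + p.2).choose p.1 : ℝ) * p.1.factorial * p.2.factorial =
    (p.1 + p.2).factorial := by rw [Nat.choose_symm_add]; exact_mod_cast h3
  simp only [SS, nsmul_eq_mul]
  rw [← h4]
  have h5 : ((p.1 + p.2).choose p.1 : ℝ) ≠ 0 := by
    exact_mod_cast (Nat.choose_pos (Nat.le_add_right _ _)).ne'
  field_simp

lemma oneF1_summable {a c : ℝ} (ha : 0 < a) (hac : a ≤ c) (z : ℝ) :
    Summable fun n : ℕ => poch a n * z ^ n / (poch c n * n.factorial) := by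
  refine Summable.of_norm_bounded (Real.summable_pow_div_factorial |z|) fun n => ?_
  have h1 := poch_pos ha n
  have h2 := poch_pos (ha.trans_le hac) n
  have h3 : poch a n / poch c n ≤ 1 := (div_le_one h2).mpr (poch_le ha hac _)
  rw [mul_div_mul_comm]
  simp only [norm_mul, norm_div, norm_pow, Real.norm_eq_abs, Nat.abs_cast, abs_of_pos h1,
    abs_of_pos h2]
  exact mul_le_of_le_one_left (by positivity) h3

lemma AA_hasSum {a c : ℝ} (ha : 0 < a) (hac : a ≤ c) (x : ℝ) (n : ℕ) :
    HasSum (AA a c x n) (poch a n * x ^ n / (poch c (2 * n) * n.factorial) *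
      oneF1 (a + n) (c + 2 * n) x) := by
  have hc := ha.trans_le hac
  have hn : (0 : ℝ) ≤ n := by positivity
  have h := (oneF1_summable (a := a + n) (c := c + 2 * n) (by positivity) (by linarith) x).hasSum
  have h' := h.mul_left (poch a n * x ^ n / (poch c (2 * n) * n.factorial))
  have hz : ∑ i ∈ Finset.range n, AA a c x n i = 0 := by
    refine Finset.sum_eq_zero fun i hi => ?_
    simp [AA, Nat.choose_eq_zero_of_lt (Finset.mem_range.mp hi)]
  rw [← hasSum_nat_add_iff' n, hz, sub_zero]
  unfold oneF1
  refine Eq.subst (motive := fun f => HasSum f _) (funext fun p => Eq.symm ?_) h'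
  have h1 := poch_add a n p
  have h2 := poch_add c (2 * n) p
  push_cast at h2
  have h3 := Nat.add_choose_mul_factorial_mul_factorial p n
  have h4 : ((p + n).choose n : ℝ) * p.factorial * n.factorial = (p + n).factorial := by
    exact_mod_cast h3
  have h5 : ((p + n).choose n : ℝ) ≠ 0 := by
    exact_mod_cast (Nat.choose_pos (Nat.le_add_left _ _)).ne'
  have h6 := (poch_pos hc (2 * n)).ne'
  have h7 := (poch_pos (show 0 < c + 2 * n by positivity) p).ne'
  unfold AA
  rw [← h4, show n + (p + n) = 2 * n + p by ring, add_comm p n, h1, h2, pow_add]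
  rw [add_comm p n] at h5
  field_simp

lemma HH_fib {a b c : ℝ} (ha : 0 < a) (hb : 0 < b) (hc : 0 < c) (hc1 : c ≠ 1)
    (habc : c = a + b) (t s : ℝ) (n : ℕ) :
    ∑' p, HH a b c t s (p, n) = poch a n * poch b n * poch (c - 1) n /
          (poch (c - 1) (2 * n) * poch c (2 * n)) *
        ((t * s) ^ n / n.factorial) *
        oneF1 (a + n) (c + 2 * n) t * oneF1 (a + n) (c + 2 * n) s := by
  have hac : a ≤ c := by linarith
  have ht := AA_hasSum ha hac t n
  have hs := AA_hasSum ha hac s n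
  simp only [HH]
  rw [tsum_mul_left, ← tsum_mul_tsum_of_summable_norm ht.summable.norm hs.summable.norm,
    ht.tsum_eq, hs.tsum_eq]
  have h1 := (poch_pos ha n).ne'
  have h2 := (poch_pos hc (2 * n)).ne'
  have h3 := poch_ne hc hc1 (2 * n)
  unfold ww vv
  rw [mul_pow]
  field_simp

/-- Addition theorem for confluent hypergeometric functions. -/
theorem addition_1F1 (α β : ℝ) (hα : -1 < α) (hβ : -1 < β) (hαβ : α + β ≠ -1)
    (t s : ℝ) :
    Summable (fun n : ℕ =>
      |poch (α + 1) n * poch (β + 1) n * poch (α + β + 1) n /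
          (poch (α + β + 1) (2 * n) * poch (α + β + 2) (2 * n)) *
        ((t * s) ^ n / n.factorial) *
        oneF1 (α + n + 1) (α + β + 2 * n + 2) t *
        oneF1 (α + n + 1) (α + β + 2 * n + 2) s|) ∧
    oneF1 (α + 1) (α + β + 2) (t + s) =
      ∑' n : ℕ, poch (α + 1) n * poch (β + 1) n * poch (α + β + 1) n /
          (poch (α + β + 1) (2 * n) * poch (α + β + 2) (2 * n)) *
        ((t * s) ^ n / n.factorial) *
        oneF1 (α + n + 1) (α + β + 2 * n + 2) t *
        oneF1 (α + n + 1) (α + β + 2 * n + 2) s := by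
  have ha : 0 < α + 1 := by linarith
  have hb : 0 < β + 1 := by linarith
  have hc : 0 < α + β + 2 := by linarith
  have hc1 : α + β + 2 ≠ 1 := fun h => hαβ (by linarith)
  have habc : α + β + 2 = (α + 1) + (β + 1) := by ring
  have hH := HH_summable ha hb hc hc1 habc t s
  have key : (fun n : ℕ => poch (α + 1) n * poch (β + 1) n * poch (α + β + 1) n /
          (poch (α + β + 1) (2 * n) * poch (α + β + 2) (2 * n)) *
        ((t * s) ^ n / n.factorial) *
        oneF1 (α + n + 1) (α + β + 2 * n + 2) t *
        oneF1 (α + n + 1) (α + β + 2 * n + 2) s) =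
      fun n => ∑' p, HH (α + 1) (β + 1) (α + β + 2) t s (p, n) := by
    ext n
    rw [HH_fib ha hb hc hc1 habc, show α + β + 2 - 1 = α + β + 1 by ring,
      show α + 1 + (n : ℝ) = α + n + 1 by ring,
      show α + β + 2 + 2 * (n : ℝ) = α + β + 2 * n + 2 by ring]
  constructor
  · refine Summable.abs ?_
    rw [key]
    exact hH.prod_symm.prod
  · rw [key, ← SS_tsum ha (by linarith) t s]
    simp_rw [← (HH_hasSum ha hc hc1 habc t s _).tsum_eq]
    exact Summable.tsum_comm (f := fun n p => HH (α + 1) (β + 1) (α + β + 2) t s (p, n))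
      hH.prod_symm
end

section
/- Let 0 < q < 1, 0 < a < 1, 0 < b < 1, let s ∈ ℝ and let t ∈ ℝ with |t| < 1. Then all series below converge absolutely and the addition formula for little q-Jacobi polynomials holds: Σ_{n=0}^∞ (aq;q)_n · ∏_{i=0}^{n-1}(t + s q^i) / ((q;q)_n (abq²;q)_n) = Σ_{j=0}^∞ [q^{3j(j-1)/2} (aq;q)_j (bq;q)_j (abq;q)_j (q a s t)^j / ((q;q)_j (abq;q)_{2j} (abq²;q)_{2j})] · ₂φ₁(0, a q^{j+1}; a b q^{2j+2}; q, t) · ₁φ₁(a q^{j+1}; a b q^{2j+2}; q, -s q^j). -/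
/-- The q-shifted factorial `(a;q)_n = ∏_{i=0}^{n-1} (1 - a q^i)`. -/
noncomputable def qpoch (a q : ℝ) (n : ℕ) : ℝ := ∏ i ∈ Finset.range n, (1 - a * q ^ i)

/-- The basic hypergeometric series `₂φ₁(A, B; C; q, z)`. -/
noncomputable def qphi21 (A B C q z : ℝ) : ℝ :=
  ∑' n : ℕ, qpoch A q n * qpoch B q n * z ^ n / (qpoch q q n * qpoch C q n)

/-- The basic hypergeometric series `₁φ₁(A; C; q, z)`. -/
noncomputable def qphi11 (A C q z : ℝ) : ℝ :=
  ∑' n : ℕ, qpoch A q n * (-1) ^ n * q ^ (n * (n - 1) / 2) * z ^ n /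
    (qpoch q q n * qpoch C q n)


/-- auxiliary product `∏_{i<j} (q^i - x)` -/
noncomputable def auxP (q x : ℝ) (j : ℕ) : ℝ := ∏ i ∈ Finset.range j, (q ^ i - x)

lemma qpoch_zero (a q : ℝ) : qpoch a q 0 = 1 := by simp [qpoch]

lemma qpoch_succ (a q : ℝ) (n : ℕ) : qpoch a q (n + 1) = qpoch a q n * (1 - a * q ^ n) := by
  simp [qpoch, Finset.prod_range_succ]

lemma qpoch_add (a q : ℝ) (m n : ℕ) :
    qpoch a q (m + n) = qpoch a q m * qpoch (a * q ^ m) q n := by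
  simp only [qpoch, Finset.prod_range_add]
  congr 1
  refine Finset.prod_congr rfl fun i _ => ?_
  rw [pow_add]; ring

lemma qpoch_succ' (a q : ℝ) (n : ℕ) : qpoch a q (n + 1) = (1 - a) * qpoch (a * q) q n := by
  rw [add_comm, qpoch_add]
  simp [qpoch]

lemma qpoch_zero_left (q : ℝ) (n : ℕ) : qpoch 0 q n = 1 := by simp [qpoch]

lemma qpoch_pos {a q : ℝ} (hq0 : 0 < q) (hq1 : q < 1) (ha1 : a < 1) (n : ℕ) :
    0 < qpoch a q n := by
  refine Finset.prod_pos fun i _ => ?_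
  have h1 : q ^ i ≤ 1 := pow_le_one₀ hq0.le hq1.le
  have h2 : 0 < q ^ i := pow_pos hq0 i
  rcases le_or_gt a 0 with h | h
  · nlinarith
  · nlinarith

lemma qpoch_le_one {a q : ℝ} (hq0 : 0 < q) (hq1 : q < 1) (ha0 : 0 ≤ a) (ha1 : a < 1) (n : ℕ) :
    qpoch a q n ≤ 1 := by
  refine Finset.prod_le_one (fun i _ => ?_) (fun i _ => ?_)
  · have h1 : q ^ i ≤ 1 := pow_le_one₀ hq0.le hq1.le
    have h2 : 0 < q ^ i := pow_pos hq0 i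
    nlinarith
  · have h2 : 0 < q ^ i := pow_pos hq0 i
    nlinarith

lemma qpoch_lower {q : ℝ} (hq0 : 0 < q) (hq1 : q < 1) :
    ∃ δ : ℝ, 0 < δ ∧ ∀ a : ℝ, a ≤ q → ∀ n, δ ≤ qpoch a q n := by
  refine ⟨Real.exp (-(q / (1 - q) * (1 - q)⁻¹)), Real.exp_pos _, fun a ha n => ?_⟩
  have h1q : 0 < 1 - q := by linarith
  have key : ∀ n, Real.exp (-(q / (1 - q) * ∑ i ∈ Finset.range n, q ^ i)) ≤ qpoch a q n := by
    intro n
    induction n with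
    | zero => simp [qpoch]
    | succ n ih =>
      rw [Finset.sum_range_succ, qpoch_succ, mul_add, neg_add, Real.exp_add]
      have hp : 0 < q ^ n := pow_pos hq0 n
      have hp1 : q ^ n ≤ 1 := pow_le_one₀ hq0.le hq1.le
      refine mul_le_mul ih ?_ (Real.exp_pos _).le (qpoch_pos hq0 hq1 (by linarith) n).le
      have h2 : a * q ^ n ≤ q * q ^ n := by nlinarith
      have h3 := Real.add_one_le_exp (q / (1 - q) * q ^ n)
      have h4 : 1 ≤ (1 - q * q ^ n) * (q / (1 - q) * q ^ n + 1) := by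
        have : (1 - q * q ^ n) * (q / (1 - q) * q ^ n + 1) - 1
          = q ^ n * q * q * (1 - q ^ n) / (1 - q) := by field_simp; ring
        have h5 : 0 ≤ q ^ n * q * q * (1 - q ^ n) / (1 - q) := by
          apply div_nonneg _ h1q.le
          apply mul_nonneg (by positivity) (by linarith)
        linarith
      have h6 : 0 < 1 - q * q ^ n := by nlinarith
      rw [Real.exp_neg, inv_le_iff_one_le_mul₀ (Real.exp_pos _)]
      have h7 := mul_le_mul_of_nonneg_left h3 h6.le
      have h8 := mul_le_mul_of_nonneg_right (sub_le_sub_left h2 1)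
        (Real.exp_pos (q / (1 - q) * q ^ n)).le
      linarith
  refine le_trans ?_ (key n)
  apply Real.exp_le_exp.2
  apply neg_le_neg
  apply mul_le_mul_of_nonneg_left _ (by positivity)
  rw [← tsum_geometric_of_lt_one hq0.le hq1]
  exact (summable_geometric_of_lt_one hq0.le hq1).sum_le_tsum _ (fun i _ => by positivity)

lemma auxP_succ (q x : ℝ) (n : ℕ) : auxP q x (n + 1) = auxP q x n * (q ^ n - x) := by
  simp [auxP, Finset.prod_range_succ]

lemma auxP_shift (q x : ℝ) (n : ℕ) :
    auxP q (q * x) (n + 1) = (1 - q * x) * (q ^ n * auxP q x n) := by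
  rw [auxP, Finset.prod_range_succ', mul_comm]
  simp only [pow_zero]
  congr 1
  rw [auxP, ← Finset.card_range n, ← Finset.prod_const, Finset.card_range,
    ← Finset.prod_mul_distrib]
  refine Finset.prod_congr rfl fun i _ => ?_
  ring

lemma auxP_eq_zero (q : ℝ) {m j : ℕ} (h : m < j) : auxP q (q ^ m) j = 0 :=
  Finset.prod_eq_zero (Finset.mem_range.2 h) (sub_self _)

lemma auxP_pow (q : ℝ) (m j : ℕ) :
    auxP q (q ^ (m + j)) j * qpoch q q m = q ^ (j.choose 2) * qpoch q q (m + j) := by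
  induction j with
  | zero => simp [auxP]
  | succ j ih =>
    have e : q ^ (m + (j + 1)) = q * q ^ (m + j) := by ring
    rw [e, auxP_shift, ← add_assoc, qpoch_succ, Nat.choose_succ_succ' j 1, Nat.choose_one_right,
      pow_add q j]
    generalize auxP q (q ^ (m + j)) j = Z at *
    linear_combination (1 - q * q ^ (m + j)) * q ^ j * ih

/-- general term of the very-well-poised series -/
noncomputable def auxT (q A B c x y : ℝ) (j : ℕ) : ℝ :=
  A ^ j * qpoch B q j * qpoch c q j * (1 - c * q ^ (2 * j)) / (1 - c) * auxP q x j * auxP q y j /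
    (qpoch q q j * qpoch A q j * qpoch (c * q * x) q j * qpoch (c * q * y) q j)

lemma auxT_tele (q A B c x y : ℝ) (hAB : A * B = c * q)
    (hq : ∀ n, qpoch q q n ≠ 0) (hA : ∀ n, qpoch A q n ≠ 0) (hc : 1 - c ≠ 0)
    (hx : ∀ n, qpoch (c * q * x) q n ≠ 0)
    (hy : ∀ n, qpoch (c * q * y) q n ≠ 0) (n : ℕ) :
    ∑ j ∈ Finset.range (n + 1), ((1 - c * q * x * y) * (1 - A * x) * auxT q A B c (q * x) y j
      - (1 - A * x * y) * (1 - c * q * x) * auxT q A B c x y j) =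
    -x * (1 - c * q * x) / (1 - c) * (auxP q x n * auxP q y (n + 1) * qpoch B q (n + 1)
      * qpoch c q (n + 1) * A ^ (n + 1)) /
      (qpoch q q n * qpoch A q n * qpoch (c * q * y) q n * qpoch (c * q * x) q (n + 1)) := by
  induction n with
  | zero =>
    have h1 := hx 1
    simp [qpoch, auxP, auxT] at h1 ⊢
    field_simp
    linear_combination (-x * (1 - y)) * hAB
  | succ n ih =>
    rw [Finset.sum_range_succ, ih]
    have hx1 : 1 - c * q * x ≠ 0 := by simpa [qpoch] using hx 1
    have e1 : qpoch (c * q * (q * x)) q (n + 1)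
        = qpoch (c * q * x) q (n + 1) * (1 - c * q * x * q ^ (n + 1)) / (1 - c * q * x) := by
      rw [eq_div_iff hx1, ← qpoch_succ, qpoch_succ' _ _ (n + 1)]
      ring_nf
    have f1 := hx (n + 1)
    have f2 := hx (n + 2)
    have f3 := hq n
    have f4 := hq (n + 1)
    have f5 := hA n
    have f6 := hA (n + 1)
    have f7 := hy n
    have f8 := hy (n + 1)
    simp only [auxT, e1, auxP_shift]
    rw [qpoch_succ _ _ (n + 1)] at f2
    rw [qpoch_succ] at f4 f6 f8
    have f2' := right_ne_zero_of_mul f2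
    have f4' := right_ne_zero_of_mul f4
    have f6' := right_ne_zero_of_mul f6
    have f8' := right_ne_zero_of_mul f8
    rw [qpoch_succ (c * q * x) q (n + 1), auxP_succ q y (n + 1), qpoch_succ B q (n + 1),
      qpoch_succ c q (n + 1), qpoch_succ q q n, qpoch_succ A q n, qpoch_succ (c * q * y) q n,
      auxP_succ q x n, pow_mul', pow_succ A (n + 1)]
    generalize qpoch (c * q * x) q (n + 1) = X1 at *
    generalize qpoch (c * q * y) q n = X2 at *
    generalize qpoch q q n = X3 at *
    generalize qpoch A q n = X4 at *
    generalize qpoch B q (n + 1) = X5 at *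
    generalize qpoch c q (n + 1) = X6 at *
    generalize auxP q x n = X7 at *
    generalize auxP q y (n + 1) = X8 at *
    generalize A ^ (n + 1) = X9 at *
    rw [pow_succ q n] at *
    generalize q ^ n = Q at *
    have e2 : 1 - c * (Q * q) = 1 - A * B * Q := by rw [hAB]; ring
    have e3 : 1 - c * (Q * q) ^ 2 = 1 - A * B * Q ^ 2 * q := by rw [hAB]; ring
    rw [e2, e3]
    rw [← hAB] at *
    obtain ⟨d2, g2⟩ : ∃ d, d = 1 - A * B * x * (Q * q) := ⟨_, rfl⟩
    obtain ⟨d4, g4⟩ : ∃ d, d = 1 - q * Q := ⟨_, rfl⟩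
    obtain ⟨d6, g6⟩ : ∃ d, d = 1 - A * Q := ⟨_, rfl⟩
    obtain ⟨d8, g8⟩ : ∃ d, d = 1 - A * B * y * Q := ⟨_, rfl⟩
    obtain ⟨d1, g1⟩ : ∃ d, d = 1 - A * B * x := ⟨_, rfl⟩
    rw [← g2] at f2' ⊢
    rw [← g4] at f4' ⊢
    rw [← g6] at f6' ⊢
    rw [← g8] at f8' ⊢
    rw [← g1] at hx1 ⊢
    field_simp
    rw [g2, g4, g6, g8]
    ring

lemma auxT_sum (q A B c y : ℝ) (hAB : A * B = c * q) (hq0 : 0 < q) (hq1 : q < 1)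
    (hA : A < 1) (hc0 : 0 < c) (hc1 : c < 1) (hy1 : y ≤ 1) (M : ℕ) :
    ∑ j ∈ Finset.range (M + 1), auxT q A B c (q ^ M) y j =
      qpoch (A * y) q M * qpoch (c * q) q M / (qpoch (c * q * y) q M * qpoch A q M) := by
  have hcq : c * q < 1 := by nlinarith
  have hcq0 : 0 < c * q := by positivity
  have hcx : ∀ x : ℝ, x ≤ 1 → ∀ n, qpoch (c * q * x) q n ≠ 0 := fun x hx n =>
    (qpoch_pos hq0 hq1 (by nlinarith) n).ne'
  have hA' : ∀ n, qpoch A q n ≠ 0 := fun n => (qpoch_pos hq0 hq1 hA n).ne'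
  have hc' : 1 - c ≠ 0 := by linarith
  induction M with
  | zero => simp [auxT, auxP, qpoch, hc']
  | succ M ih =>
    have hx1 : q ^ M ≤ 1 := pow_le_one₀ hq0.le hq1.le
    have hx0 : 0 < q ^ M := pow_pos hq0 M
    have h := auxT_tele q A B c (q ^ M) y hAB (fun n => (qpoch_pos hq0 hq1 hq1 n).ne') hA' hc'
      (hcx _ hx1) (hcx _ hy1) (M + 1)
    rw [auxP_eq_zero q (Nat.lt_succ_self M), Finset.sum_sub_distrib, ← Finset.mul_sum,
      ← Finset.mul_sum, Finset.sum_range_succ (fun j => auxT q A B c (q ^ M) y j), ih] at h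
    have h0 : auxT q A B c (q ^ M) y (M + 1) = 0 := by
      simp [auxT, auxP_eq_zero q (Nat.lt_succ_self M)]
    rw [h0] at h
    rw [pow_succ' q M]
    rw [qpoch_succ, qpoch_succ, qpoch_succ, qpoch_succ]
    have n1 := hcx y hy1 M
    have n2 := hcx y hy1 (M + 1)
    have n3 := hA' M
    have n4 := hA' (M + 1)
    rw [qpoch_succ] at n2 n4
    have n2' := right_ne_zero_of_mul n2
    have n4' := right_ne_zero_of_mul n4
    rw [eq_div_iff (by positivity)]
    simp only [zero_mul, mul_zero, zero_div, add_zero] at h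
    have h2 := sub_eq_zero.1 h
    have h3 : (1 - c * q * q ^ M * y) * (1 - A * q ^ M) *
      (∑ j ∈ Finset.range (M + 1 + 1), auxT q A B c (q * q ^ M) y j) *
        (qpoch (c * q * y) q M * qpoch A q M) =
        (1 - A * q ^ M * y) * (1 - c * q * q ^ M) * (qpoch (A * y) q M * qpoch (c * q) q M) := by
      rw [h2, mul_assoc, div_mul_cancel₀ _ (mul_ne_zero n1 n3)]
    linear_combination h3

lemma qbinom (q s t : ℝ) (hq0 : 0 < q) (hq1 : q < 1) (n : ℕ) :
    (∏ i ∈ Finset.range n, (t + s * q ^ i)) / qpoch q q n =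
    ∑ p ∈ Finset.HasAntidiagonal.antidiagonal n, t ^ p.1 / qpoch q q p.1 *
      (q ^ (p.2.choose 2) * s ^ p.2 / qpoch q q p.2) := by
  have hq : ∀ n, qpoch q q n ≠ 0 := fun n => (qpoch_pos hq0 hq1 hq1 n).ne'
  have h1 : ∀ n, (1 - q ^ (n + 1)) ≠ 0 := fun n => by
    have := pow_lt_one₀ hq0.le hq1 (Nat.succ_ne_zero n)
    simp only [Nat.succ_eq_add_one] at this
    linarith
  induction n with
  | zero => simp [qpoch]
  | succ n ih =>
    set e : ℕ → ℝ := fun m => t ^ m / qpoch q q m with he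
    set f : ℕ → ℝ := fun k => q ^ (k.choose 2) * s ^ k / qpoch q q k with hf
    have hq' : ∀ n, qpoch q q (n + 1) = qpoch q q n * (1 - q ^ (n + 1)) := fun n => by
      rw [qpoch_succ, pow_succ' q n]
    have he1 : ∀ m, (1 - q ^ (m + 1)) * e (m + 1) = t * e m := fun m => by
      have := hq m; have := h1 m
      simp only [he, hq']
      field_simp
      ring
    have hf1 : ∀ m, (1 - q ^ (m + 1)) * f (m + 1) = s * q ^ m * f m := fun m => by
      have := hq m; have := h1 m
      simp only [hf, hq']
      generalize 1 - q ^ (m + 1) = z at *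
      rw [Nat.choose_succ_succ' m 1, Nat.choose_one_right, pow_add q m]
      field_simp
      ring
    change _ = ∑ p ∈ Finset.HasAntidiagonal.antidiagonal (n + 1), e p.1 * f p.2
    change _ = ∑ p ∈ Finset.HasAntidiagonal.antidiagonal n, e p.1 * f p.2 at ih
    have key : (1 - q ^ (n + 1)) * ∑ p ∈ Finset.HasAntidiagonal.antidiagonal (n + 1), e p.1 * f p.2
        = (t + s * q ^ n) * ∑ p ∈ Finset.HasAntidiagonal.antidiagonal n, e p.1 * f p.2 := by
      have a1 : (1 - q ^ (n + 1)) * ∑ p ∈ Finset.HasAntidiagonal.antidiagonal (n + 1), e p.1 * f p.2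
        = ∑ p ∈ Finset.HasAntidiagonal.antidiagonal (n + 1), ((1 - q ^ p.1) * e p.1) * f p.2
         + ∑ p ∈ Finset.HasAntidiagonal.antidiagonal (n + 1), (q ^ p.1 * e p.1) * ((1 - q ^ p.2) * f p.2) := by
        rw [Finset.mul_sum, ← Finset.sum_add_distrib]
        refine Finset.sum_congr rfl fun p hp => ?_
        rw [← Finset.HasAntidiagonal.mem_antidiagonal.1 hp, pow_add]
        ring
      rw [a1, Finset.Nat.sum_antidiagonal_succ, Finset.Nat.sum_antidiagonal_succ']
      simp only [he1, hf1, pow_zero, sub_self, zero_mul, mul_zero, zero_add]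
      rw [← Finset.sum_add_distrib, Finset.mul_sum]
      refine Finset.sum_congr rfl fun p hp => ?_
      rw [← Finset.HasAntidiagonal.mem_antidiagonal.1 hp, pow_add]
      ring
    rw [← ih] at key
    rw [Finset.prod_range_succ, hq', div_eq_iff (mul_ne_zero (hq n) (h1 n))]
    have := hq n
    field_simp at key
    linear_combination -key

lemma summable_theta {q : ℝ} (hq0 : 0 < q) (hq1 : q < 1) (u : ℝ) :
    Summable (fun n : ℕ => q ^ (n.choose 2) * |u| ^ n) := by
  rcases eq_or_ne u 0 with rfl | hu
  · refine summable_of_ne_finset_zero (s := {0}) fun n hn => ?_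
    simp at hn
    simp [hn]
  have hu' : 0 < |u| := abs_pos.2 hu
  refine summable_of_ratio_test_tendsto_lt_one (l := 0) one_pos
    (Filter.Eventually.of_forall fun n => by positivity) ?_
  have h : (fun n : ℕ => q ^ n * |u|) = fun n : ℕ =>
      ‖q ^ ((n + 1).choose 2) * |u| ^ (n + 1)‖ / ‖q ^ (n.choose 2) * |u| ^ n‖ := by
    funext n
    rw [Real.norm_of_nonneg (by positivity), Real.norm_of_nonneg (by positivity),
      Nat.choose_succ_succ' n 1, Nat.choose_one_right, pow_add q n]
    field_simp
    ring
  rw [← h]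
  simpa using (tendsto_pow_atTop_nhds_zero_of_lt_one hq0.le hq1).mul_const |u|

lemma tsum_antidiag (g : ℕ × ℕ → ℝ) (hg : Summable g) :
    Summable (fun n : ℕ => ∑ p ∈ Finset.HasAntidiagonal.antidiagonal n, g p) ∧
    ∑' n : ℕ, ∑ p ∈ Finset.HasAntidiagonal.antidiagonal n, g p = ∑' p, g p := by
  let e := Finset.HasAntidiagonal.sigmaAntidiagonalEquivProd (A := ℕ)
  have h1 : Summable (g ∘ e) := e.summable_iff.2 hg
  have h2 : ∀ n : ℕ, ∑' p : (Finset.HasAntidiagonal.antidiagonal n), (g ∘ e) ⟨n, p⟩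
      = ∑ p ∈ Finset.HasAntidiagonal.antidiagonal n, g p := by
    intro n
    rw [tsum_fintype]
    exact Finset.sum_coe_sort (Finset.HasAntidiagonal.antidiagonal n) g
  constructor
  · have := h1.sigma
    simpa only [h2] using this
  · rw [← e.tsum_eq g]
    have := h1.tsum_sigma
    simp only [h2] at this
    exact this.symm

/-- outer coefficient -/
noncomputable def cfC (q a b s t : ℝ) (j : ℕ) : ℝ :=
  q ^ (3 * (j * (j - 1) / 2)) * qpoch (a * q) q j * qpoch (b * q) q j *
          qpoch (a * b * q) q j * (q * a * s * t) ^ j /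
          (qpoch q q j * qpoch (a * b * q) q (2 * j) *
            qpoch (a * b * q ^ 2) q (2 * j))

/-- terms of the first inner series -/
noncomputable def cfU (q a b t : ℝ) (j n : ℕ) : ℝ :=
  qpoch 0 q n * qpoch (a * q ^ (j + 1)) q n * t ^ n /
        (qpoch q q n * qpoch (a * b * q ^ (2 * j + 2)) q n)

/-- terms of the second inner series -/
noncomputable def cfV (q a b s : ℝ) (j n : ℕ) : ℝ :=
  qpoch (a * q ^ (j + 1)) q n * (-1) ^ n * q ^ (n * (n - 1) / 2) *
          (-(s * q ^ j)) ^ n /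
        (qpoch q q n * qpoch (a * b * q ^ (2 * j + 2)) q n)

/-- full coefficient of the left side -/
noncomputable def cfG (q a b s t : ℝ) (p : ℕ × ℕ) : ℝ :=
  qpoch (a * q) q (p.1 + p.2) / qpoch (a * b * q ^ 2) q (p.1 + p.2) *
   (t ^ p.1 / qpoch q q p.1 * (q ^ (p.2.choose 2) * s ^ p.2 / qpoch q q p.2))

/-- expanded terms -/
noncomputable def cfF (q a b s t : ℝ) (j : ℕ) (p : ℕ × ℕ) : ℝ :=
  q ^ (p.2.choose 2) * s ^ p.2 * t ^ p.1 * qpoch (a * q) q p.1 * qpoch (a * q) q p.2 /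
    (qpoch q q p.1 * qpoch q q p.2 * qpoch (a * b * q ^ 2) q p.1 * qpoch (a * b * q ^ 2) q p.2) *
  auxT q (a * q) (b * q) (a * b * q) (q ^ p.1) (q ^ p.2) j

section
variable {q a b s t : ℝ}

lemma cfF_zero {j : ℕ} {p : ℕ × ℕ} (h : p.1 < j ∨ p.2 < j) : cfF q a b s t j p = 0 := by
  rcases h with h | h <;> simp [cfF, auxT, auxP_eq_zero q h]

lemma cfF_sum (hq0 : 0 < q) (hq1 : q < 1) (ha0 : 0 < a) (ha1 : a < 1)
    (hb0 : 0 < b) (hb1 : b < 1) (p : ℕ × ℕ) :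
    HasSum (fun j => cfF q a b s t j p) (cfG q a b s t p) := by
  obtain ⟨M, K⟩ := p
  have hab0 : 0 < a * b := by positivity
  have hab : a * b < 1 := by nlinarith
  have haq : a * q < 1 := by nlinarith
  have habq : a * b * q < 1 := by nlinarith
  have habq2 : a * b * q ^ 2 < 1 := by nlinarith [mul_pos hab0 hq0]
  have h1 : ∑ j ∈ Finset.range (M + 1), cfF q a b s t j (M, K) = cfG q a b s t (M, K) := by
    simp only [cfF, cfG]
    rw [← Finset.mul_sum, auxT_sum q (a * q) (b * q) (a * b * q) (q ^ K) (by ring) hq0 hq1 haq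
      (by positivity) habq (pow_le_one₀ hq0.le hq1.le) M]
    have e : a * b * q * q = a * b * q ^ 2 := by ring
    rw [e, add_comm M K, qpoch_add (a * q), qpoch_add (a * b * q ^ 2)]
    have n1 := (qpoch_pos hq0 hq1 haq M).ne'
    have n2 := (qpoch_pos hq0 hq1 haq K).ne'
    have n3 := (qpoch_pos hq0 hq1 habq2 M).ne'
    have n4 := (qpoch_pos hq0 hq1 habq2 K).ne'
    have n5 := (qpoch_pos hq0 hq1 hq1 M).ne'
    have n6 := (qpoch_pos hq0 hq1 hq1 K).ne'
    have n7 : qpoch (a * b * q ^ 2 * q ^ K) q M ≠ 0 := (qpoch_pos hq0 hq1 (by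
      have : q ^ K ≤ 1 := pow_le_one₀ hq0.le hq1.le
      have : 0 < a * b * q ^ 2 := by positivity
      nlinarith) M).ne'
    generalize qpoch (a * b * q ^ 2 * q ^ K) q M = Z1 at *
    generalize qpoch (a * b * q ^ 2) q M = Z2 at *
    generalize qpoch (a * b * q ^ 2) q K = Z3 at *
    generalize qpoch (a * q) q M = Z4 at *
    generalize qpoch (a * q) q K = Z5 at *
    field_simp
  rw [← h1]
  refine hasSum_sum_of_ne_finset_zero fun j hj => cfF_zero (Or.inl ?_)
  simpa using hj

set_option maxHeartbeats 1000000 in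
lemma cfF_eq (hq0 : 0 < q) (hq1 : q < 1) (ha0 : 0 < a) (ha1 : a < 1)
    (hb0 : 0 < b) (hb1 : b < 1) (j m k : ℕ) :
    cfF q a b s t j (m + j, k + j) = cfC q a b s t j * (cfU q a b t j m * cfV q a b s j k) := by
  have hab0 : 0 < a * b := by positivity
  have hab : a * b < 1 := by nlinarith
  have haq : a * q < 1 := by nlinarith
  have habq : a * b * q < 1 := by nlinarith
  have habq2 : a * b * q ^ 2 < 1 := by nlinarith [mul_pos hab0 hq0]
  have hc' : 1 - a * b * q ≠ 0 := by linarith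
  simp only [cfF, cfC, cfU, cfV, auxT, ← Nat.choose_two_right, qpoch_zero_left]
  -- shifted factorial relations
  have nq : ∀ n, qpoch q q n ≠ 0 := fun n => (qpoch_pos hq0 hq1 hq1 n).ne'
  have nA : ∀ n, qpoch (a * q) q n ≠ 0 := fun n => (qpoch_pos hq0 hq1 haq n).ne'
  have nC : ∀ n, qpoch (a * b * q) q n ≠ 0 := fun n => (qpoch_pos hq0 hq1 habq n).ne'
  have nD : ∀ n, qpoch (a * b * q ^ 2) q n ≠ 0 := fun n => (qpoch_pos hq0 hq1 habq2 n).ne'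
  have hP : ∀ m, auxP q (q ^ (m + j)) j = q ^ (j.choose 2) * qpoch q q (m + j) / qpoch q q m :=
    fun m => by rw [eq_div_iff (nq m), auxP_pow]
  have hA : ∀ m, qpoch (a * q) q (m + j) = qpoch (a * q) q j * qpoch (a * q ^ (j + 1)) q m :=
    fun m => by
      rw [add_comm, qpoch_add, pow_succ' q j, mul_assoc a q]
  have e2 : a * b * q * q = a * b * q ^ 2 := by ring
  have hD : ∀ m, qpoch (a * b * q * q * q ^ (m + j)) q j
      = qpoch (a * b * q ^ 2) q (2 * j) * qpoch (a * b * q ^ (2 * j + 2)) q m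
        / qpoch (a * b * q ^ 2) q (m + j) := fun m => by
    have e3 : a * b * q ^ (2 * j + 2) = a * b * q ^ 2 * q ^ (2 * j) := by ring
    rw [eq_div_iff (nD _), e2, mul_comm, ← qpoch_add, e3, ← qpoch_add]
    congr 1
    ring
  have hDm : ∀ m, qpoch (a * b * q ^ (2 * j + 2)) q m ≠ 0 := fun m => by
    have e3 : a * b * q ^ (2 * j + 2) = a * b * q ^ 2 * q ^ (2 * j) := by ring
    have := nD (2 * j + m)
    rw [qpoch_add, ← e3] at this
    exact right_ne_zero_of_mul this
  have hC : 1 - a * b * q * q ^ (2 * j)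
      = (1 - a * b * q) * qpoch (a * b * q ^ 2) q (2 * j) / qpoch (a * b * q) q (2 * j) := by
    rw [eq_div_iff (nC _), mul_comm, ← qpoch_succ, qpoch_succ', e2]
  have hk : (k + j).choose 2 = k.choose 2 + j.choose 2 + j * k := by
    have := Nat.add_choose_eq k j 2
    simp [Finset.Nat.antidiagonal_succ] at this
    rw [this]; ring
  have hs : (-1 : ℝ) ^ k * (-(s * q ^ j)) ^ k = s ^ k * q ^ (j * k) := by
    rw [← mul_pow]; ring
  have hs' : ∀ x y : ℝ, x * (-1) ^ k * y * (-(s * q ^ j)) ^ k = x * y * (s ^ k * q ^ (j * k)) :=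
    fun x y => by rw [← hs]; ring
  rw [hs', hP, hP, hD, hD, hC, hA, hA, hk, pow_add q, pow_add q, pow_mul' q 3]
  have a1 := nq m
  have a2 := nq k
  have a3 := nq j
  have a4 := nq (m + j)
  have a5 := nq (k + j)
  have a6 := nD (m + j)
  have a7 := nD (k + j)
  have a8 := nD (2 * j)
  have a9 := nC (2 * j)
  have b1 := nA j
  have b2 := hDm m
  have b3 := hDm k
  generalize q ^ (j * k) = Q1
  generalize q ^ (j.choose 2) = Q2
  generalize q ^ (k.choose 2) = Q3
  generalize qpoch (a * b * q ^ (2 * j + 2)) q m = Z1 at *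
  generalize qpoch (a * b * q ^ (2 * j + 2)) q k = Z2 at *
  generalize qpoch (a * b * q ^ 2) q (m + j) = Z3 at *
  generalize qpoch (a * b * q ^ 2) q (k + j) = Z4 at *
  generalize qpoch (a * b * q ^ 2) q (2 * j) = Z5 at *
  generalize qpoch (a * b * q) q (2 * j) = Z6 at *
  generalize qpoch (a * b * q) q j = Z7 at *
  generalize qpoch (a * q) q j = Z8 at *
  generalize qpoch (b * q) q j = Z9 at *
  generalize qpoch (a * q ^ (j + 1)) q m = Y1 at *
  generalize qpoch (a * q ^ (j + 1)) q k = Y2 at *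
  generalize qpoch q q (m + j) = Y3 at *
  generalize qpoch q q (k + j) = Y4 at *
  generalize 1 - a * b * q = Y5 at *
  simp only [mul_pow, pow_add]
  generalize q ^ j = W1
  generalize a ^ j = W2
  generalize s ^ j = W3
  generalize t ^ j = W4
  generalize s ^ k = W5
  generalize t ^ m = W6
  generalize qpoch q q m = Y6 at *
  generalize qpoch q q k = Y7 at *
  generalize qpoch q q j = Y8 at *
  clear nq nA nC nD hP hA hD hDm hC hs hs' e2 hk
  have key : ∀ L R : ℝ, L = R * (Y3 / Y3) * (Y4 / Y4) * (Z3 / Z3) * (Z4 / Z4) * (Z8 / Z8) *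
      (Z5 / Z5) * (Y5 / Y5) → L = R := by
    intro L R h
    rw [h, div_self a4, div_self a5, div_self a6, div_self a7, div_self b1, div_self a8,
      div_self hc']
    simp only [mul_one]
  apply key
  simp only [div_eq_mul_inv, mul_inv, inv_inv]
  ring

lemma abs_div_bound {x y C d : ℝ} (hd : 0 < d) (hx : |x| ≤ C) (hy : d ≤ y) : |x / y| ≤ C / d := by
  rw [abs_div, abs_of_pos (lt_of_lt_of_le hd hy)]
  exact div_le_div₀ (le_trans (abs_nonneg _) hx) hx hd hy

lemma cf_bounds (hq0 : 0 < q) (hq1 : q < 1) (ha0 : 0 < a) (ha1 : a < 1)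
    (hb0 : 0 < b) (hb1 : b < 1) :
    ∃ δ : ℝ, 0 < δ ∧
    (∀ j n, |cfU q a b t j n| ≤ |t| ^ n / (δ * δ)) ∧
    (∀ j n, |cfV q a b s j n| ≤ q ^ (n.choose 2) * |s| ^ n / (δ * δ)) ∧
    (∀ j, |cfC q a b s t j| ≤ q ^ (j.choose 2) * |q * a * s * t| ^ j / (δ * δ * δ)) ∧
    (∀ p : ℕ × ℕ, |cfG q a b s t p| ≤
      1 / δ * (|t| ^ p.1 / δ * (q ^ (p.2.choose 2) * |s| ^ p.2 / δ))) := by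
  obtain ⟨δ, hδ, hl⟩ := qpoch_lower hq0 hq1
  have hab0 : 0 < a * b := by positivity
  have hab : a * b < 1 := by nlinarith
  have haq : a * q < 1 := by nlinarith
  have hbq : b * q < 1 := by nlinarith
  have habq : a * b * q < 1 := by nlinarith
  have hqp : ∀ n, q ^ n ≤ 1 := fun n => pow_le_one₀ hq0.le hq1.le
  have hqp0 : ∀ n, 0 < q ^ n := fun n => pow_pos hq0 n
  have hqs : ∀ n, q ^ (n + 1) ≤ q := fun n => by
    rw [pow_succ]; nlinarith [hqp n]
  have hup : ∀ x, 0 ≤ x → x < 1 → ∀ n, |qpoch x q n| ≤ 1 := fun x h0 h1 n => by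
    rw [abs_of_pos (qpoch_pos hq0 hq1 h1 n)]
    exact qpoch_le_one hq0 hq1 h0 h1 n
  have haj : ∀ j, a * q ^ (j + 1) < 1 := fun j => by
    nlinarith [hqs j, hqp0 (j + 1)]
  have habj : ∀ j, a * b * q ^ (j + 1) ≤ q := fun j => by
    nlinarith [hqs j, hqp0 (j + 1)]
  refine ⟨δ, hδ, fun j n => ?_, fun j n => ?_, fun j => ?_, fun p => ?_⟩
  · refine abs_div_bound (by positivity) ?_ ?_
    · rw [qpoch_zero_left, one_mul, abs_mul, abs_pow]
      exact mul_le_of_le_one_left (by positivity) (hup _ (by positivity) (haj j) n)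
    · exact mul_le_mul (hl _ le_rfl n) (hl _ (habj _) n) hδ.le
        (qpoch_pos hq0 hq1 hq1 n).le
  · refine abs_div_bound (by positivity) ?_ ?_
    · rw [← Nat.choose_two_right, abs_mul, abs_mul, abs_mul, abs_pow (-1 : ℝ), abs_neg, abs_one,
        one_pow, mul_one, abs_pow (-(s * q ^ j)), abs_neg, abs_mul s, mul_pow, abs_pow, abs_pow,
        abs_of_pos hq0]
      have h1 : (q ^ j) ^ n ≤ 1 := pow_le_one₀ (hqp0 j).le (hqp j)
      have h2 := hup _ (by positivity) (haj j) n
      have h3 : |s| ^ n * (q ^ j) ^ n ≤ |s| ^ n := mul_le_of_le_one_right (by positivity) h1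
      refine mul_le_mul ?_ h3 (by positivity) (by positivity)
      exact mul_le_of_le_one_left (by positivity) h2
    · exact mul_le_mul (hl _ le_rfl n) (hl _ (habj _) n) hδ.le
        (qpoch_pos hq0 hq1 hq1 n).le
  · refine abs_div_bound (by positivity) ?_ ?_
    · rw [← Nat.choose_two_right, abs_mul, abs_mul, abs_mul, abs_mul, abs_pow,
        abs_pow (q * a * s * t), abs_of_pos hq0]
      refine mul_le_mul_of_nonneg_right ?_ (by positivity)
      have h0 : q ^ (3 * j.choose 2) ≤ q ^ (j.choose 2) :=
        pow_le_pow_of_le_one hq0.le hq1.le (by omega)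
      have h1 := hup (a * q) (by positivity) haq j
      have h2 := hup (b * q) (by positivity) hbq j
      have h3 := hup (a * b * q) (by positivity) habq j
      calc _ ≤ q ^ (j.choose 2) * 1 * 1 * 1 := by gcongr
        _ = _ := by ring
    · have h1 := hl _ le_rfl j
      have h2 := hl (a * b * q) (by simpa using habj 0) (2 * j)
      have h3 := hl (a * b * q ^ 2) (habj 1) (2 * j)
      have h4 := hδ.trans_le h1
      have h5 := hδ.trans_le h2
      gcongr
  · rw [cfG, abs_mul, abs_mul]
    gcongr
    · exact abs_div_bound hδ (hup _ (by positivity) haq _) (hl _ (habj 1) _)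
    · exact abs_div_bound hδ (by rw [abs_pow]) (hl _ le_rfl _)
    · exact abs_div_bound hδ (by rw [abs_mul, abs_pow, abs_pow, abs_of_pos hq0]) (hl _ le_rfl _)

end

/-- Addition formula attached to the little q-Jacobi polynomials. -/
theorem little_q_jacobi_addition (q a b s t : ℝ)
    (hq0 : 0 < q) (hq1 : q < 1) (ha0 : 0 < a) (ha1 : a < 1)
    (hb0 : 0 < b) (hb1 : b < 1) (ht : |t| < 1) :
    Summable (fun n : ℕ =>
      |qpoch (a * q) q n * (∏ i ∈ Finset.range n, (t + s * q ^ i)) /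
        (qpoch q q n * qpoch (a * b * q ^ 2) q n)|) ∧
    (∀ j : ℕ, Summable (fun n : ℕ =>
      |qpoch 0 q n * qpoch (a * q ^ (j + 1)) q n * t ^ n /
        (qpoch q q n * qpoch (a * b * q ^ (2 * j + 2)) q n)|)) ∧
    (∀ j : ℕ, Summable (fun n : ℕ =>
      |qpoch (a * q ^ (j + 1)) q n * (-1) ^ n * q ^ (n * (n - 1) / 2) *
          (-(s * q ^ j)) ^ n /
        (qpoch q q n * qpoch (a * b * q ^ (2 * j + 2)) q n)|)) ∧
    Summable (fun j : ℕ =>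
      |q ^ (3 * (j * (j - 1) / 2)) * qpoch (a * q) q j * qpoch (b * q) q j *
          qpoch (a * b * q) q j * (q * a * s * t) ^ j /
          (qpoch q q j * qpoch (a * b * q) q (2 * j) *
            qpoch (a * b * q ^ 2) q (2 * j)) *
        qphi21 0 (a * q ^ (j + 1)) (a * b * q ^ (2 * j + 2)) q t *
        qphi11 (a * q ^ (j + 1)) (a * b * q ^ (2 * j + 2)) q (-(s * q ^ j))|) ∧
    (∑' n : ℕ, qpoch (a * q) q n * (∏ i ∈ Finset.range n, (t + s * q ^ i)) /
        (qpoch q q n * qpoch (a * b * q ^ 2) q n)) =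
      ∑' j : ℕ,
        q ^ (3 * (j * (j - 1) / 2)) * qpoch (a * q) q j * qpoch (b * q) q j *
          qpoch (a * b * q) q j * (q * a * s * t) ^ j /
          (qpoch q q j * qpoch (a * b * q) q (2 * j) *
            qpoch (a * b * q ^ 2) q (2 * j)) *
        qphi21 0 (a * q ^ (j + 1)) (a * b * q ^ (2 * j + 2)) q t *
        qphi11 (a * q ^ (j + 1)) (a * b * q ^ (2 * j + 2)) q (-(s * q ^ j)) := by
  obtain ⟨δ, hδ, bU, bV, bC, bG⟩ := cf_bounds (s := s) (t := t) hq0 hq1 ha0 ha1 hb0 hb1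
  have st : Summable (fun n : ℕ => |t| ^ n) := summable_geometric_of_lt_one (abs_nonneg t) ht
  have ss := summable_theta hq0 hq1 s
  have sc := summable_theta hq0 hq1 (q * a * s * t)
  have sU : ∀ j, Summable (fun n => |cfU q a b t j n|) := fun j =>
    Summable.of_nonneg_of_le (fun _ => abs_nonneg _) (bU j) (st.div_const _)
  have sV : ∀ j, Summable (fun n => |cfV q a b s j n|) := fun j =>
    Summable.of_nonneg_of_le (fun _ => abs_nonneg _) (bV j) (ss.div_const _)
  have sUV := (st.div_const (δ * δ)).mul_of_nonneg (ss.div_const (δ * δ))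
    (fun n => by simp only [Pi.zero_apply]; positivity)
    (fun n => by simp only [Pi.zero_apply]; positivity)
  have sf0 := (sc.div_const (δ * δ * δ)).mul_of_nonneg sUV
    (fun n => by simp only [Pi.zero_apply]; positivity)
    (fun n => by simp only [Pi.zero_apply]; positivity)
  -- the triple family
  let f : ℕ × (ℕ × ℕ) → ℝ := fun x =>
    cfC q a b s t x.1 * (cfU q a b t x.1 x.2.1 * cfV q a b s x.1 x.2.2)
  have sf : Summable f := by
    refine Summable.of_norm_bounded sf0 fun x => ?_
    simp only [f, norm_mul, Real.norm_eq_abs]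
    refine mul_le_mul (bC _) (mul_le_mul (bU _ _) (bV _ _) (abs_nonneg _) (by positivity))
      (by positivity) (by positivity)
  let F : ℕ × (ℕ × ℕ) → ℝ := fun x => cfF q a b s t x.1 x.2
  let ι : ℕ × (ℕ × ℕ) → ℕ × (ℕ × ℕ) := fun x => (x.1, (x.2.1 + x.1, x.2.2 + x.1))
  have hι : Function.Injective ι := by
    rintro ⟨j, m, k⟩ ⟨j', m', k'⟩ h
    simp only [ι, Prod.mk.injEq] at h ⊢
    omega
  have hFι : F ∘ ι = f := by
    funext x
    exact cfF_eq hq0 hq1 ha0 ha1 hb0 hb1 _ _ _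
  have hF0 : ∀ x, x ∉ Set.range ι → F x = 0 := by
    rintro ⟨j, m, k⟩ hx
    apply cfF_zero
    by_contra! h
    refine hx ⟨(j, (m - j, k - j)), ?_⟩
    simp only [ι, Prod.mk.injEq, true_and]
    simp only at h
    omega
  have sF : Summable F := by
    rw [← hι.summable_iff hF0, hFι]
    exact sf
  have tF : ∑' x, F x = ∑' x, f x := by
    rw [← hι.tsum_eq (f := F) (by
      intro x hx
      by_contra h
      exact hx (hF0 x h))]
    exact tsum_congr fun x => congrFun hFι x
  have tf : ∀ j, ∑' p : ℕ × ℕ, f (j, p) =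
      cfC q a b s t j * qphi21 0 (a * q ^ (j + 1)) (a * b * q ^ (2 * j + 2)) q t *
        qphi11 (a * q ^ (j + 1)) (a * b * q ^ (2 * j + 2)) q (-(s * q ^ j)) := by
    intro j
    simp only [f]
    have sU' : Summable (fun n => ‖cfU q a b t j n‖) := by
      simpa only [Real.norm_eq_abs] using sU j
    have sV' : Summable (fun n => ‖cfV q a b s j n‖) := by
      simpa only [Real.norm_eq_abs] using sV j
    rw [tsum_mul_left, ← tsum_mul_tsum_of_summable_norm sU' sV', mul_assoc]
    simp only [qphi21, qphi11, cfU, cfV]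
  have sR := sf.prod
  simp only [tf] at sR
  have sG0 := ((st.div_const δ).mul_of_nonneg (ss.div_const δ)
    (fun n => by simp only [Pi.zero_apply]; positivity)
    (fun n => by simp only [Pi.zero_apply]; positivity)).mul_left (1 / δ)
  have sG : Summable (cfG q a b s t) := Summable.of_norm_bounded sG0 bG
  obtain ⟨sL, tL⟩ := tsum_antidiag _ sG
  have hL : ∀ n : ℕ, ∑ p ∈ Finset.HasAntidiagonal.antidiagonal n, cfG q a b s t p =
      qpoch (a * q) q n * (∏ i ∈ Finset.range n, (t + s * q ^ i)) /
        (qpoch q q n * qpoch (a * b * q ^ 2) q n) := by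
    intro n
    have h1 : ∑ p ∈ Finset.HasAntidiagonal.antidiagonal n, cfG q a b s t p =
        qpoch (a * q) q n / qpoch (a * b * q ^ 2) q n *
        ((∏ i ∈ Finset.range n, (t + s * q ^ i)) / qpoch q q n) := by
      rw [qbinom q s t hq0 hq1, Finset.mul_sum]
      refine Finset.sum_congr rfl fun p hp => ?_
      rw [cfG, Finset.HasAntidiagonal.mem_antidiagonal.1 hp]
    rw [h1, div_mul_div_comm, mul_comm (qpoch q q n)]
  simp only [hL] at sL tL
  refine ⟨sL.abs, sU, sV, sR.abs, ?_⟩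
  rw [tL]
  have hswap : Summable (fun x : (ℕ × ℕ) × ℕ => F (x.2, x.1)) :=
    (Equiv.prodComm (ℕ × ℕ) ℕ).summable_iff.2 sF
  calc ∑' p, cfG q a b s t p = ∑' p : ℕ × ℕ, ∑' j : ℕ, F (j, p) :=
        tsum_congr fun p => (cfF_sum hq0 hq1 ha0 ha1 hb0 hb1 p).tsum_eq.symm
    _ = ∑' x : (ℕ × ℕ) × ℕ, F (x.2, x.1) := hswap.tsum_prod.symm
    _ = ∑' x, F x := (Equiv.prodComm (ℕ × ℕ) ℕ).tsum_eq F
    _ = ∑' x, f x := tF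
    _ = ∑' j, ∑' p : ℕ × ℕ, f (j, p) := sf.tsum_prod
    _ = _ := tsum_congr tf
end

section
/- Let 0 < q < 1 and -1 < β < 1. For j ∈ ℕ and t ∈ ℝ with t ≠ 0, define Q_j(t;β,q) = (2^{j+1}/t) · Σ_{k=0}^∞ (j+2k+1) · I_{j+2k+1}(t) · (∏_{i=0}^{k-1}(β - q^{i+1})) · (q^{j+1};q)_k / ((q;q)_k (β q^{j+1};q)_k), a series which converges absolutely. Then for all nonzero real s, t with s + t ≠ 0, the addition formula for functions attached to the continuous q-ultraspherical polynomials holds: Q_0(s+t;β,q) = Σ_{n=0}^∞ [(q;q)_n (β²;q)_n / (4^n (β;q)_n (qβ;q)_n)] · Q_n(s;β,q) · Q_n(t;β,q), the series converging absolutely. -/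
/-- The modified Bessel function `I_m(t)` of integer order `m ≥ 0`. -/
noncomputable def besselI (m : ℕ) (t : ℝ) : ℝ :=
  ∑' r : ℕ, (t / 2) ^ (m + 2 * r) / (r.factorial * (m + r).factorial)

/-- The function `Q_j(t; β, q)` attached to the continuous q-ultraspherical
polynomials. -/
noncomputable def Qqultra (q β : ℝ) (j : ℕ) (t : ℝ) : ℝ :=
  (2 ^ (j + 1) / t) *
    ∑' k : ℕ, ((j : ℝ) + 2 * k + 1) * besselI (j + 2 * k + 1) t *
      (∏ i ∈ Finset.range k, (β - q ^ (i + 1))) * qpoch (q ^ (j + 1)) q k /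
      (qpoch q q k * qpoch (β * q ^ (j + 1)) q k)

namespace QU

lemma hasSum_of_eq {ι : Type*} (v w : ℝ) (f g : ι → ℝ) (h : HasSum f v)
    (h1 : ∀ k, g k = f k) (h2 : w = v) : HasSum g w := by
  rw [h2, funext h1]; exact h

/-- Coefficients of `x^m` in monic orthogonal polynomials with recurrence coefficients `lam`. -/
noncomputable def cc (lam : ℕ → ℝ) : ℕ → ℕ → ℝ
  | 0, 0 => 1
  | 0, _ + 1 => 0
  | m + 1, 0 => lam 0 * cc lam m 1
  | m + 1, n + 1 => cc lam m n + lam (n + 1) * cc lam m (n + 2)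

lemma cc_zero_of_lt (lam : ℕ → ℝ) : ∀ m n, m < n → cc lam m n = 0
  | 0, 0, h => by omega
  | 0, _ + 1, _ => by simp [cc]
  | m + 1, 0, h => by omega
  | m + 1, n + 1, h => by
    rw [cc, cc_zero_of_lt lam m n (by omega), cc_zero_of_lt lam m (n + 2) (by omega)]; simp

lemma cc_nonneg (lam : ℕ → ℝ) (h0 : ∀ n, 0 ≤ lam n) : ∀ m n, 0 ≤ cc lam m n
  | 0, 0 => by simp [cc]
  | 0, _ + 1 => by simp [cc]
  | m + 1, 0 => by rw [cc]; exact mul_nonneg (h0 _) (cc_nonneg lam h0 m 1)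
  | m + 1, n + 1 => by
    rw [cc]
    exact add_nonneg (cc_nonneg lam h0 m n) (mul_nonneg (h0 _) (cc_nonneg lam h0 m (n + 2)))

lemma cc_le (lam : ℕ → ℝ) (L : ℝ) (h0 : ∀ n, 0 ≤ lam n) (h1 : ∀ n, lam n ≤ L) :
    ∀ m n, cc lam m n ≤ (1 + L) ^ m
  | 0, 0 => by simp [cc]
  | 0, _ + 1 => by simp [cc]
  | m + 1, 0 => by
    have hL : 0 ≤ L := (h0 0).trans (h1 0)
    have := mul_le_mul (h1 0) (cc_le lam L h0 h1 m 1) (cc_nonneg lam h0 m 1) hL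
    have h2 : 0 ≤ (1 + L) ^ m := by positivity
    rw [cc, pow_succ]; nlinarith
  | m + 1, n + 1 => by
    have hL : 0 ≤ L := (h0 0).trans (h1 0)
    have := mul_le_mul (h1 (n + 1)) (cc_le lam L h0 h1 m (n + 2)) (cc_nonneg lam h0 m (n + 2)) hL
    have h3 := cc_le lam L h0 h1 m n
    rw [cc, pow_succ]; nlinarith

/-- squared norms -/
noncomputable def hh (lam : ℕ → ℝ) (n : ℕ) : ℝ := ∏ i ∈ Finset.range n, lam i

lemma hh_succ (lam : ℕ → ℝ) (n : ℕ) : hh lam (n + 1) = hh lam n * lam n := by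
  simp [hh, Finset.prod_range_succ]

lemma cd (lam : ℕ → ℝ) (a b N : ℕ) :
    ∑ n ∈ Finset.range (N + 1), hh lam n * (cc lam (a + 1) n * cc lam b n
      - cc lam a n * cc lam (b + 1) n) =
    hh lam (N + 1) * (cc lam a (N + 1) * cc lam b N - cc lam a N * cc lam b (N + 1)) := by
  induction N with
  | zero => simp [cc, hh]; ring
  | succ N ih =>
    rw [Finset.sum_range_succ, ih, hh_succ lam (N + 1)]
    simp only [cc]; ring

lemma sum_cc (lam : ℕ → ℝ) : ∀ a b N, a + b ≤ N →
    ∑ n ∈ Finset.range (N + 1), hh lam n * (cc lam a n * cc lam b n) = cc lam (a + b) 0 := by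
  intro a b
  induction b generalizing a with
  | zero =>
    intro N _
    rw [Finset.sum_eq_single 0]
    · simp [cc, hh]
    · intro n _ hn
      rw [cc_zero_of_lt lam 0 n (by omega)]; simp
    · simp
  | succ b ih =>
    intro N h
    have h1 := ih (a + 1) N (by omega)
    have h2 := cd lam a b N
    rw [cc_zero_of_lt lam a (N + 1) (by omega), cc_zero_of_lt lam b (N + 1) (by omega)] at h2
    simp only [mul_sub, Finset.sum_sub_distrib] at h2
    rw [h1] at h2
    have : a + (b + 1) = a + 1 + b := by ring
    rw [this]; linarith

lemma hasSum_cc (lam : ℕ → ℝ) (a b : ℕ) :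
    HasSum (fun n => hh lam n * (cc lam a n * cc lam b n)) (cc lam (a + b) 0) := by
  rw [← sum_cc lam a b (a + b) le_rfl]
  apply hasSum_sum_of_ne_finset_zero
  intro n hn
  simp at hn
  rw [cc_zero_of_lt lam a n (by omega)]; simp

/-- The ballot numbers. -/
noncomputable abbrev bb : ℕ → ℕ → ℝ := cc (fun _ => 1)

lemma bb_le (m n : ℕ) : bb m n ≤ 2 ^ m := by
  have := cc_le (fun _ => 1) 1 (by simp) (by simp) m n
  norm_num at this; exact this

lemma bb_nonneg (m n : ℕ) : 0 ≤ bb m n := cc_nonneg _ (by simp) m n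

lemma bb_odd : ∀ m l, (m + l) % 2 = 1 → bb m l = 0
  | 0, 0, h => by omega
  | 0, _ + 1, _ => by simp [cc]
  | m + 1, 0, h => by
    have h1 := bb_odd m 1 (by omega)
    simp only [bb] at h1
    rw [bb, cc, h1]; simp
  | m + 1, n + 1, h => by
    have h1 := bb_odd m n (by omega)
    have h2 := bb_odd m (n + 2) (by omega)
    simp only [bb] at h1 h2
    rw [bb, cc, h1, h2]; simp

lemma bb_eq : ∀ m l r, m = l + 2 * r →
    bb m l * ((r.factorial : ℝ) * (l + 1 + r).factorial) = (l + 1) * m.factorial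
  | 0, 0, r, h => by
    obtain rfl : r = 0 := by omega
    simp [cc]
  | 0, _ + 1, _, h => by omega
  | m + 1, 0, r, h => by
    obtain ⟨r, rfl⟩ : ∃ r', r = r' + 1 := ⟨r - 1, by omega⟩
    have ih := bb_eq m 1 r (by omega)
    have hm : (m : ℝ) = 1 + 2 * r := by rw [show m = 1 + 2 * r by omega]; push_cast; ring
    have e1 : 0 + 1 + (r + 1) = 1 + 1 + r := by ring
    rw [bb, cc, e1, Nat.factorial_succ r, Nat.factorial_succ m]
    push_cast at ih ⊢
    rw [hm]
    linear_combination (r + 1 : ℝ) * ih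
  | m + 1, l + 1, 0, h => by
    have ih := bb_eq m l 0 (by omega)
    obtain rfl : m = l := by omega
    rw [bb, cc, cc_zero_of_lt _ m (m + 2) (by omega)]
    simp only [Nat.add_zero, Nat.factorial_succ] at ih ⊢
    push_cast at ih ⊢
    linear_combination (m + 2 : ℝ) * ih
  | m + 1, l + 1, r + 1, h => by
    have ih := bb_eq m l (r + 1) (by omega)
    have ih2 := bb_eq m (l + 2) r (by omega)
    have hm : (m : ℝ) = l + 2 * r + 2 := by rw [show m = l + 2 * r + 2 by omega]; push_cast; ring
    have e1 : l + 1 + (r + 1) = (l + 1 + r) + 1 := by ring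
    have e2 : l + 2 + 1 + r = (l + 1 + r) + 1 + 1 := by ring
    have e3 : l + 1 + 1 + (r + 1) = (l + 1 + r) + 1 + 1 := by ring
    rw [e1] at ih
    rw [e2] at ih2
    rw [bb, cc, e3]
    simp only [Nat.factorial_succ] at ih ih2 ⊢
    push_cast at ih ih2 ⊢
    rw [hm]
    linear_combination (l + r + 3 : ℝ) * ih + (r + 1 : ℝ) * ih2

lemma hasSum_bb_summable (l : ℕ) (t : ℝ) :
    Summable (fun m : ℕ => bb m l * (t / 2) ^ m / m.factorial) := by
  refine Summable.of_norm_bounded (g := fun m : ℕ => |t| ^ m / m.factorial)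
    (Real.summable_pow_div_factorial _) ?_
  intro m
  rw [norm_div, norm_mul, norm_pow]
  simp only [Real.norm_eq_abs, Nat.abs_cast, abs_of_nonneg (bb_nonneg m l)]
  gcongr
  calc bb m l * |t / 2| ^ m ≤ 2 ^ m * |t / 2| ^ m := by gcongr; exact bb_le m l
    _ = |t| ^ m := by rw [← mul_pow, abs_div]; norm_num; congr 1; ring

lemma bessel_eq (l : ℕ) (t : ℝ) :
    ((l : ℝ) + 1) * besselI (l + 1) t = (t / 2) * ∑' m : ℕ, bb m l * (t / 2) ^ m / m.factorial := by
  have hinj : Function.Injective (fun r : ℕ => l + 2 * r) := by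
    intro a b h; simp at h; exact h
  have hs : Function.support (fun m : ℕ => bb m l * (t / 2) ^ m / (m.factorial : ℝ)) ⊆
      Set.range (fun r : ℕ => l + 2 * r) := by
    intro m hm
    by_contra hc
    apply hm
    have : bb m l = 0 := by
      by_cases h : m < l
      · exact cc_zero_of_lt _ _ _ h
      · by_cases h2 : (m + l) % 2 = 1
        · exact bb_odd _ _ h2
        · exact absurd ⟨(m - l) / 2, by simp only; omega⟩ hc
    simp [this]
  rw [← hinj.tsum_eq hs, besselI, ← tsum_mul_left, ← tsum_mul_left]
  congr 1; ext r
  have h := bb_eq (l + 2 * r) l r rfl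
  have f1 : (r.factorial : ℝ) ≠ 0 := by positivity
  have f2 : ((l + 1 + r).factorial : ℝ) ≠ 0 := by positivity
  have f3 : ((l + 2 * r).factorial : ℝ) ≠ 0 := by positivity
  have e : l + 1 + 2 * r = (l + 2 * r) + 1 := by ring
  rw [e, pow_succ]
  generalize t / 2 = u
  rw [mul_div_assoc', mul_div_assoc', div_eq_div_iff (by positivity) (by positivity)]
  linear_combination (-u ^ (l + 2 * r) * u) * h

section params
variable {q β : ℝ}

noncomputable def aa (q β : ℝ) (j k : ℕ) : ℝ :=
  (∏ i ∈ Finset.range k, (β - q ^ (i + 1))) * qpoch (q ^ (j + 1)) q k /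
      (qpoch q q k * qpoch (β * q ^ (j + 1)) q k)

noncomputable def lm (q β : ℝ) (n : ℕ) : ℝ :=
  (1 - q ^ (n + 1)) * (1 - β ^ 2 * q ^ n) / (4 * (1 - β * q ^ n) * (1 - β * q ^ (n + 1)))

lemma den_ge (hq0 : 0 < q) (hq1 : q < 1) (n : ℕ) :
    1 - |β| ≤ 1 - β * q ^ n := by
  have h1 : q ^ n ≤ 1 := pow_le_one₀ hq0.le hq1.le
  have h2 : 0 < q ^ n := by positivity
  have := le_abs_self β
  nlinarith [abs_nonneg β]

lemma den_pos (hq0 : 0 < q) (hq1 : q < 1) (hb : |β| < 1) (n : ℕ) :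
    0 < 1 - β * q ^ n := lt_of_lt_of_le (by linarith) (den_ge hq0 hq1 n)

lemma qp_pos (hq0 : 0 < q) (hq1 : q < 1) (n : ℕ) : 0 < 1 - q ^ (n + 1) := by
  have := pow_lt_one₀ hq0.le hq1 (n := n + 1) (by omega)
  linarith

lemma qpoch_succ (x q : ℝ) (n : ℕ) : qpoch x q (n + 1) = qpoch x q n * (1 - x * q ^ n) := by
  simp [qpoch, Finset.prod_range_succ]

lemma qpoch_succ' (x q : ℝ) (n : ℕ) : qpoch x q (n + 1) = (1 - x) * qpoch (x * q) q n := by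
  simp [qpoch, Finset.prod_range_succ']
  rw [mul_comm]; congr 1
  apply Finset.prod_congr rfl; intros; ring

lemma qpoch_shift (x q : ℝ) (n : ℕ) :
    qpoch (x * q) q n * (1 - x) = qpoch x q n * (1 - x * q ^ n) := by
  rw [← qpoch_succ, qpoch_succ']; ring

lemma qpoch_q_pos (hq0 : 0 < q) (hq1 : q < 1) (k : ℕ) : 0 < qpoch q q k := by
  apply Finset.prod_pos
  intro i _
  have := qp_pos hq0 hq1 i
  rw [pow_succ] at this; linarith

lemma qpoch_b_pos (hq0 : 0 < q) (hq1 : q < 1) (hb : |β| < 1) (j k : ℕ) :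
    0 < qpoch (β * q ^ j) q k := by
  apply Finset.prod_pos
  intro i _
  have := den_pos hq0 hq1 hb (j + i)
  rw [pow_add] at this; linarith

lemma aa_zero (j : ℕ) : aa q β j 0 = 1 := by simp [aa, qpoch]

lemma aa_succ_k (j k : ℕ) :
    aa q β j (k + 1) = aa q β j k * ((β - q ^ (k + 1)) * (1 - q ^ (j + 1) * q ^ k) /
      ((1 - q ^ (k + 1)) * (1 - β * q ^ (j + 1) * q ^ k))) := by
  rw [aa, aa, Finset.prod_range_succ, qpoch_succ, qpoch_succ, qpoch_succ, div_mul_div_comm]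
  congr 1 <;> ring

lemma aa_succ_j (hq0 : 0 < q) (hq1 : q < 1) (hb : |β| < 1) (j k : ℕ) :
    aa q β (j + 1) k = aa q β j k * ((1 - q ^ (j + 1) * q ^ k) * (1 - β * q ^ (j + 1)) /
      ((1 - q ^ (j + 1)) * (1 - β * q ^ (j + 1) * q ^ k))) := by
  have h1 := qpoch_shift (q ^ (j + 1)) q k
  have h2 := qpoch_shift (β * q ^ (j + 1)) q k
  have p1 := (qp_pos hq0 hq1 j).ne'
  have p2 := (qpoch_q_pos hq0 hq1 k).ne'
  have p3 := (qpoch_b_pos hq0 hq1 hb (j + 1) k).ne'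
  have p4 := (qpoch_b_pos hq0 hq1 hb (j + 1 + 1) k).ne'
  have p5 := (den_pos hq0 hq1 hb (j + 1 + k)).ne'
  rw [mul_assoc, ← pow_succ] at h2
  rw [← pow_succ] at h1
  rw [pow_add, ← mul_assoc] at p5
  rw [aa, aa, div_mul_div_comm, div_eq_div_iff (by positivity) (by positivity)]
  generalize qpoch (q ^ (j + 1 + 1)) q k = X at *
  generalize qpoch (q ^ (j + 1)) q k = X' at *
  generalize qpoch (β * q ^ (j + 1 + 1)) q k = Y at *
  generalize qpoch (β * q ^ (j + 1)) q k = Y' at *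
  generalize (∏ i ∈ Finset.range k, (β - q ^ (i + 1))) = P at *
  generalize qpoch q q k = Z at *
  linear_combination (P * Z * Y' * (1 - β * q ^ (j + 1) * q ^ k)) * h1 -
    (P * Z * X' * (1 - q ^ (j + 1) * q ^ k)) * h2

lemma aa_rec0 (hq0 : 0 < q) (hq1 : q < 1) (hb : |β| < 1) (k : ℕ) :
    aa q β 0 k + aa q β 0 (k + 1) = 4 * lm q β 0 * aa q β 1 k := by
  have e := aa_succ_j hq0 hq1 hb 0 k
  rw [zero_add] at e
  rw [e, aa_succ_k, lm]
  have p1 := (qp_pos hq0 hq1 0).ne'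
  have p2 := (qp_pos hq0 hq1 k).ne'
  have p3 := (den_pos hq0 hq1 hb 0).ne'
  have p4 := (den_pos hq0 hq1 hb 1).ne'
  have p5 := (den_pos hq0 hq1 hb (1 + k)).ne'
  simp only [pow_add, pow_zero, pow_one, zero_add, mul_one, ← mul_assoc] at *
  generalize q ^ k = y at *
  generalize hD2 : 1 - y * q = D2 at p2 ⊢
  generalize hD5 : 1 - β * q * y = D5 at p5 ⊢
  generalize hD1 : 1 - q = D1 at p1 ⊢
  generalize hD3 : 1 - β = D3 at p3 ⊢
  generalize hD4 : 1 - β * q = D4 at p4 ⊢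
  field_simp
  subst hD2 hD5 hD1 hD3 hD4
  ring

lemma aa_rec (hq0 : 0 < q) (hq1 : q < 1) (hb : |β| < 1) (j k : ℕ) :
    aa q β (j + 1) (k + 1) + aa q β (j + 1) k =
      aa q β j (k + 1) + 4 * lm q β (j + 1) * aa q β (j + 2) k := by
  rw [aa_succ_j hq0 hq1 hb (j + 1) k, aa_succ_k, aa_succ_k, aa_succ_j hq0 hq1 hb j k, lm]
  have p1 := (qp_pos hq0 hq1 j).ne'
  have p1' := (qp_pos hq0 hq1 (j + 1)).ne'
  have p2 := (qp_pos hq0 hq1 k).ne'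
  have p3 := (den_pos hq0 hq1 hb (j + 1)).ne'
  have p4 := (den_pos hq0 hq1 hb (j + 2)).ne'
  have p5 := (den_pos hq0 hq1 hb (j + 1 + k)).ne'
  have p6 := (den_pos hq0 hq1 hb (j + 2 + k)).ne'
  have p7 := (qp_pos hq0 hq1 (j + k)).ne'
  have s2 : q ^ (j + 2) = q ^ j * q * q := by ring
  have s3 : q ^ (j + 1 + 1) = q ^ j * q * q := by ring
  have s4 : q ^ (j + 1 + k) = q ^ j * q * q ^ k := by ring
  have s5 : q ^ (j + 2 + k) = q ^ j * q * q * q ^ k := by ring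
  have s1 : q ^ (j + 1) = q ^ j * q := by ring
  have s6 : q ^ (k + 1) = q ^ k * q := by ring
  have s7 : q ^ (j + k + 1) = q ^ j * q ^ k * q := by ring
  rw [s7] at p7
  simp only [s2, s3, s4, s5, s1, s6, ← mul_assoc] at *
  generalize q ^ j = x at *
  generalize q ^ k = y at *
  generalize aa q β j k = A
  generalize hD1 : 1 - x * q = D1 at p1 ⊢
  generalize hD1' : 1 - x * q * q = D1' at p1' ⊢
  generalize hD2 : 1 - y * q = D2 at p2 ⊢
  generalize hD3 : 1 - β * x * q = D3 at p3 ⊢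
  generalize hD4 : 1 - β * x * q * q = D4 at p4 ⊢
  generalize hD5 : 1 - β * x * q * y = D5 at p5 ⊢
  generalize hD6 : 1 - β * x * q * q * y = D6 at p6 ⊢
  field_simp
  subst hD1 hD1' hD2 hD3 hD4 hD5 hD6
  ring

lemma lm_nonneg (hq0 : 0 < q) (hq1 : q < 1) (hb : |β| < 1) (n : ℕ) : 0 ≤ lm q β n := by
  have h1 := qp_pos hq0 hq1 n
  have h2 := den_pos hq0 hq1 hb n
  have h3 := den_pos hq0 hq1 hb (n + 1)
  have h4 := den_pos (β := β ^ 2) hq0 hq1 (by rw [abs_pow]; nlinarith [abs_nonneg β]) n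
  rw [lm]; positivity

lemma lm_le (hq0 : 0 < q) (hq1 : q < 1) (hb : |β| < 1) (n : ℕ) :
    lm q β n ≤ 1 / (4 * (1 - |β|) * (1 - |β|)) := by
  have h1 := qp_pos hq0 hq1 n
  have h2 := den_ge (β := β) hq0 hq1 n
  have h3 := den_ge (β := β) hq0 hq1 (n + 1)
  have h4 := den_pos (β := β ^ 2) hq0 hq1 (by rw [abs_pow]; nlinarith [abs_nonneg β]) n
  have h5 : 0 < 1 - |β| := by linarith
  have h6 : 0 < q ^ (n + 1) := by positivity
  have h7 : 0 ≤ β ^ 2 * q ^ n := by positivity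
  have h8 : 0 < 1 - β * q ^ n := by linarith
  rw [lm]
  gcongr
  nlinarith

lemma aa_bound (hq0 : 0 < q) (hq1 : q < 1) (hb : |β| < 1) (j k : ℕ) :
    |aa q β j k| ≤ (2 / ((1 - q) * (1 - |β|))) ^ k := by
  induction k with
  | zero => simp [aa_zero]
  | succ k ih =>
    rw [aa_succ_k, abs_mul, pow_succ (2 / ((1 - q) * (1 - |β|)))]
    refine mul_le_mul ih ?_ (abs_nonneg _) ((abs_nonneg _).trans ih)
    have h5 : 0 < 1 - |β| := by linarith
    have h6 : 0 < 1 - q := by linarith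
    have h1 := qp_pos hq0 hq1 k
    have h2 := den_ge (β := β) hq0 hq1 (j + 1 + k)
    have h7 := qp_pos hq0 hq1 (j + k)
    have e : q ^ (j + k + 1) = q ^ (j + 1) * q ^ k := by ring
    rw [e] at h7
    rw [pow_add, ← mul_assoc] at h2
    have h8 : q ^ (k + 1) ≤ q := by
      rw [pow_succ]; have := pow_le_one₀ (n := k) hq0.le hq1.le; nlinarith
    have h9 : 0 < q ^ (k + 1) := by positivity
    have h10 : 0 < q ^ (j + 1) * q ^ k := by positivity
    have h11 : |β - q ^ (k + 1)| ≤ 2 := by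
      rw [abs_le]; rw [abs_lt] at hb; constructor <;> linarith [hb.1, hb.2]
    rw [abs_div, abs_mul, abs_mul, abs_of_pos h1, abs_of_pos h7, abs_of_pos (h5.trans_le h2)]
    have h12 : q ^ (k + 1) ≤ q := h8
    apply div_le_div₀ (by norm_num) ?_ (by positivity) ?_
    · nlinarith [abs_nonneg (β - q ^ (k + 1))]
    · apply mul_le_mul (by linarith) h2 h5.le h1.le

lemma hh_eq (hq0 : 0 < q) (hq1 : q < 1) (hb : |β| < 1) (n : ℕ) :
    qpoch q q n * qpoch (β ^ 2) q n / (4 ^ n * qpoch β q n * qpoch (q * β) q n)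
      = hh (lm q β) n := by
  induction n with
  | zero => simp [qpoch, hh]
  | succ n ih =>
    rw [hh_succ, ← ih, lm, qpoch_succ, qpoch_succ, qpoch_succ, qpoch_succ, div_mul_div_comm]
    congr 1 <;> ring

/-- Connection formula. -/
lemma conn (hq0 : 0 < q) (hq1 : q < 1) (hb : |β| < 1) (m : ℕ) : ∀ j : ℕ,
    HasSum (fun k => 2 ^ j * (aa q β j k * bb m (j + 2 * k))) (2 ^ m * cc (lm q β) m j) := by
  induction m with
  | zero =>
    intro j
    have : 2 ^ 0 * cc (lm q β) 0 j = 2 ^ j * (aa q β j 0 * bb 0 (j + 2 * 0)) := by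
      cases j <;> simp [cc, aa_zero]
    rw [this]
    apply hasSum_single
    intro k hk
    rw [bb, cc_zero_of_lt _ 0 _ (by omega)]; simp
  | succ m ih =>
    intro j
    cases j with
    | zero =>
      have h := (ih 1).mul_left (2 * lm q β 0)
      have e : ∀ k, 2 * lm q β 0 * (2 ^ 1 * (aa q β 1 k * bb m (1 + 2 * k))) =
          (aa q β 0 k + aa q β 0 (k + 1)) * bb m (1 + 2 * k) := by
        intro k; rw [aa_rec0 hq0 hq1 hb]; ring
      simp only [e] at h
      -- split off via summability
      have hfin : ∀ f : ℕ → ℝ, Summable (fun k => f k * bb m (1 + 2 * k)) := by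
        intro f
        apply summable_of_ne_finset_zero (s := Finset.range (m + 1))
        intro k hk
        simp at hk
        rw [bb, cc_zero_of_lt _ _ _ (by omega)]; simp
      have hA := (hfin (fun k => aa q β 0 k)).hasSum
      have hB := (hfin (fun k => aa q β 0 (k + 1))).hasSum
      have hB' : HasSum (fun k => match k with
          | 0 => 0
          | k + 1 => aa q β 0 (k + 1) * bb m (1 + 2 * k)) (∑' k, aa q β 0 (k + 1) * bb m (1 + 2 * k)) := by
        rw [← hasSum_nat_add_iff' 1]
        simpa using hB
      have hS := hA.add hB'
      have hu := h.unique (by simpa only [add_mul] using hA.add hB)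
      rw [show 2 ^ (m + 1) * cc (lm q β) (m + 1) 0 =
        2 * lm q β 0 * (2 ^ m * cc (lm q β) m 1) by rw [cc]; ring, hu]
      convert hS using 1
      ext k
      cases k with
      | zero => simp [bb, cc]
      | succ k =>
        simp only [bb]
        rw [show 0 + 2 * (k + 1) = (2 * k + 1) + 1 by ring, cc,
          show 1 + 2 * (k + 1) = 2 * k + 1 + 2 by ring, show 1 + 2 * k = 2 * k + 1 by ring]
        ring
    | succ j =>
      have h1 := (ih j).mul_left 2
      have h2 := (ih (j + 2)).mul_left (2 * lm q β (j + 1))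
      have e : ∀ k, 2 * lm q β (j + 1) * (2 ^ (j + 2) * (aa q β (j + 2) k * bb m (j + 2 + 2 * k))) =
          2 ^ (j + 1) * ((aa q β (j + 1) (k + 1) + aa q β (j + 1) k - aa q β j (k + 1)) *
            bb m (j + 2 * (k + 1))) := by
        intro k; rw [aa_rec hq0 hq1 hb, show j + 2 * (k + 1) = j + 2 + 2 * k by ring]; ring
      simp only [e] at h2
      have h1' := (hasSum_nat_add_iff' 1).mpr h1
      have hfin : Summable (fun k => 2 ^ (j + 1) * (aa q β (j + 1) k * bb m (j + 2 * k))) := by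
        apply summable_of_ne_finset_zero (s := Finset.range (m + 1))
        intro k hk
        simp at hk
        rw [bb, cc_zero_of_lt _ _ _ (by omega)]; simp
      have hX := hfin.hasSum
      have hX' := (hasSum_nat_add_iff' 1).mpr hX
      have hS := ((h1'.add h2).sub hX').add hX
      refine hasSum_of_eq _ _ _ _ hS (fun k => ?_) ?_
      · simp only [bb]
        rw [show j + 1 + 2 * k = (j + 2 * k) + 1 by ring, cc,
          show j + 2 * (k + 1) = j + 2 * k + 2 by ring]
        ring
      · simp only [Finset.sum_range_one, aa_zero, cc]
        ring

/-- The `n`-th function as a power series. -/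
lemma double_summable (hq0 : 0 < q) (hq1 : q < 1) (hb : |β| < 1) (j : ℕ) (t : ℝ) :
    Summable (fun p : ℕ × ℕ => aa q β j p.1 *
      (bb p.2 (j + 2 * p.1) * (t / 2) ^ p.2 / (p.2.factorial : ℝ))) := by
  set C : ℝ := 2 / ((1 - q) * (1 - |β|)) with hC
  have h5 : 0 < 1 - |β| := by linarith
  have h6 : 0 < 1 - q := by linarith
  have hC0 : 0 < C := by positivity
  have hC1 : 1 ≤ C := by
    rw [hC, le_div_iff₀ (by positivity)]; nlinarith [abs_nonneg β]
  have hg : Summable (fun p : ℕ × ℕ => ((1 / 2 : ℝ) ^ p.1) *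
      ((2 * C * |t|) ^ p.2 / (p.2.factorial : ℝ))) :=
    Summable.mul_of_nonneg (summable_geometric_two) (Real.summable_pow_div_factorial _)
      (fun _ => by positivity) (fun _ => by positivity)
  refine Summable.of_norm_bounded hg ?_
  rintro ⟨k, m⟩
  simp only [norm_mul, norm_div, norm_pow, Real.norm_eq_abs, Nat.abs_cast,
    abs_of_nonneg (bb_nonneg m _)]
  by_cases hkm : m < j + 2 * k
  · rw [bb, cc_zero_of_lt _ _ _ hkm]; simp; positivity
  · have hk : k ≤ m := by omega
    have h7 : |aa q β j k| ≤ C ^ m :=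
      (aa_bound hq0 hq1 hb j k).trans (pow_le_pow_right₀ hC1 hk)
    have h8 : (1 : ℝ) ≤ (1 / 2) ^ k * 2 ^ m := by
      rw [one_div, inv_pow, inv_mul_eq_div, le_div_iff₀ (by positivity), one_mul]
      exact pow_le_pow_right₀ (by norm_num) hk
    calc |aa q β j k| * (bb m (j + 2 * k) * (|t| / |2|) ^ m / (m.factorial : ℝ))
        ≤ C ^ m * (2 ^ m * (|t| / |2|) ^ m / (m.factorial : ℝ)) := by
          gcongr
          · exact div_nonneg (mul_nonneg (bb_nonneg _ _) (by positivity)) (by positivity)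
          · exact bb_le _ _
      _ = 1 * ((C * |t|) ^ m / (m.factorial : ℝ)) := by
          rw [← mul_pow, ← mul_div_assoc, ← mul_pow]; norm_num; congr 2; ring
      _ ≤ ((1 / 2) ^ k * 2 ^ m) * ((C * |t|) ^ m / (m.factorial : ℝ)) := by gcongr
      _ = _ := by rw [mul_assoc 2 C, mul_pow 2 (C * |t|)]; ring

lemma term_eq (j k : ℕ) (t : ℝ) :
    ((j : ℝ) + 2 * k + 1) * besselI (j + 2 * k + 1) t *
        (∏ i ∈ Finset.range k, (β - q ^ (i + 1))) * qpoch (q ^ (j + 1)) q k /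
        (qpoch q q k * qpoch (β * q ^ (j + 1)) q k) =
    (t / 2) * ∑' m : ℕ, aa q β j k * (bb m (j + 2 * k) * (t / 2) ^ m / (m.factorial : ℝ)) := by
  have h := bessel_eq (j + 2 * k) t
  push_cast at h
  rw [tsum_mul_left, h, aa]; ring

lemma term_summable (hq0 : 0 < q) (hq1 : q < 1) (hb : |β| < 1) (j : ℕ) (t : ℝ) :
    Summable (fun k : ℕ => |((j : ℝ) + 2 * k + 1) * besselI (j + 2 * k + 1) t *
        (∏ i ∈ Finset.range k, (β - q ^ (i + 1))) * qpoch (q ^ (j + 1)) q k /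
        (qpoch q q k * qpoch (β * q ^ (j + 1)) q k)|) := by
  simp only [term_eq]
  exact ((double_summable hq0 hq1 hb j t).prod.mul_left (t / 2)).abs

lemma Q_hasSum (hq0 : 0 < q) (hq1 : q < 1) (hb : |β| < 1) (j : ℕ) (t : ℝ) (ht : t ≠ 0) :
    HasSum (fun m : ℕ => cc (lm q β) m j * t ^ m / (m.factorial : ℝ)) (Qqultra q β j t) := by
  have hd := double_summable hq0 hq1 hb j t
  have e : Qqultra q β j t = 2 ^ j * ∑' p : ℕ × ℕ, aa q β j p.1 *
      (bb p.2 (j + 2 * p.1) * (t / 2) ^ p.2 / (p.2.factorial : ℝ)) := by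
    rw [Qqultra]
    simp only [term_eq]
    rw [tsum_mul_left, hd.tsum_prod]
    field_simp
    ring
  rw [e]
  have h1 := ((Equiv.prodComm ℕ ℕ).hasSum_iff.mpr hd.hasSum).mul_left (2 ^ j)
  refine h1.prod_fiberwise ?_
  intro m
  have h2 := (conn hq0 hq1 hb m j).mul_right ((t / 2) ^ m / (m.factorial : ℝ))
  convert h2 using 1
  · ext k; simp; ring
  · rw [div_pow]; field_simp

set_option maxHeartbeats 1000000 in
lemma addition (hq0 : 0 < q) (hq1 : q < 1) (hb : |β| < 1) (s t : ℝ) (hs : s ≠ 0) (ht : t ≠ 0)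
    (hst : s + t ≠ 0) :
    HasSum (fun n => hh (lm q β) n * Qqultra q β n s * Qqultra q β n t)
      (Qqultra q β 0 (s + t)) := by
  obtain ⟨lam, hlam⟩ : ∃ lam, lam = lm q β := ⟨_, rfl⟩
  have h0 : ∀ n, 0 ≤ lam n := by rw [hlam]; exact lm_nonneg hq0 hq1 hb
  obtain ⟨R, hR1, hR⟩ : ∃ R : ℝ, 1 ≤ R ∧ ∀ m, cc lam m 0 ≤ R ^ m := by
    refine ⟨1 + 1 / (4 * (1 - |β|) * (1 - |β|)), ?_, fun m => ?_⟩
    · have h5 : 0 < 1 - |β| := by linarith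
      have : 0 < 1 / (4 * (1 - |β|) * (1 - |β|)) := by positivity
      linarith
    · rw [hlam]; exact cc_le _ _ (lm_nonneg hq0 hq1 hb) (lm_le hq0 hq1 hb) m 0
  have hQ := Q_hasSum hq0 hq1 hb
  rw [← hlam] at hQ ⊢
  have hh0 : ∀ n, 0 ≤ hh lam n := fun n => Finset.prod_nonneg (fun i _ => h0 i)
  have hle : ∀ n a b, hh lam n * (cc lam a n * cc lam b n) ≤ R ^ a * R ^ b := by
    intro n a b
    rw [← pow_add]
    refine le_trans ?_ (hR (a + b))
    exact le_hasSum (hasSum_cc lam a b) n (fun i _ =>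
      mul_nonneg (hh0 i) (mul_nonneg (cc_nonneg _ h0 _ _) (cc_nonneg _ h0 _ _)))
  have hR0 : 0 < R := by linarith
  have hF : Summable (fun p : ℕ × (ℕ × ℕ) => hh lam p.1 * (cc lam p.2.1 p.1 * cc lam p.2.2 p.1) *
      (s ^ p.2.1 / (p.2.1.factorial : ℝ) * (t ^ p.2.2 / (p.2.2.factorial : ℝ)))) := by
    have hg1 : Summable (fun p : ℕ × ℕ => ((2 * R * |s|) ^ p.1 / (p.1.factorial : ℝ)) *
        ((R * |t|) ^ p.2 / (p.2.factorial : ℝ))) :=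
      Summable.mul_of_nonneg (Real.summable_pow_div_factorial _) (Real.summable_pow_div_factorial _)
        (fun _ => by positivity) (fun _ => by positivity)
    have hg : Summable (fun p : ℕ × (ℕ × ℕ) => ((1 / 2 : ℝ) ^ p.1) *
        (((2 * R * |s|) ^ p.2.1 / (p.2.1.factorial : ℝ)) *
        ((R * |t|) ^ p.2.2 / (p.2.2.factorial : ℝ)))) :=
      Summable.mul_of_nonneg (f := fun n : ℕ => (1 / 2 : ℝ) ^ n)
        (g := fun p : ℕ × ℕ => ((2 * R * |s|) ^ p.1 / (p.1.factorial : ℝ)) *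
        ((R * |t|) ^ p.2 / (p.2.factorial : ℝ))) (summable_geometric_two) hg1
        (fun _ => by positivity) (fun _ => by positivity)
    refine Summable.of_norm_bounded hg ?_
    rintro ⟨n, a, b⟩
    have hn : 0 ≤ hh lam n * (cc lam a n * cc lam b n) :=
      mul_nonneg (hh0 n) (mul_nonneg (cc_nonneg _ h0 _ _) (cc_nonneg _ h0 _ _))
    simp only [norm_mul _ (s ^ a / (a.factorial : ℝ) * (t ^ b / (b.factorial : ℝ))),
      Real.norm_of_nonneg hn]
    simp only [norm_mul, norm_div, norm_pow, Real.norm_eq_abs, Nat.abs_cast]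
    by_cases hna : a < n
    · rw [cc_zero_of_lt _ _ _ hna]; simp; positivity
    · have h8 : (1 : ℝ) ≤ (1 / 2) ^ n * 2 ^ a := by
        rw [one_div, inv_pow, inv_mul_eq_div, le_div_iff₀ (by positivity), one_mul]
        exact pow_le_pow_right₀ (by norm_num) (by omega)
      calc _ ≤ (R ^ a * R ^ b) * (|s| ^ a / (a.factorial : ℝ) * (|t| ^ b / (b.factorial : ℝ))) := by
            exact mul_le_mul_of_nonneg_right (hle n a b) (by positivity)
        _ ≤ ((1 / 2) ^ n * 2 ^ a) * ((R ^ a * R ^ b) *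
            (|s| ^ a / (a.factorial : ℝ) * (|t| ^ b / (b.factorial : ℝ)))) :=
            le_mul_of_one_le_left (by positivity) h8
        _ = _ := by rw [mul_pow, mul_pow, mul_pow]; ring
  -- sum over (a,b) first
  have hA := hF.hasSum.prod_fiberwise (g := fun n => hh lam n * Qqultra q β n s * Qqultra q β n t) (by
    intro n
    have hs1 : Summable (fun p : ℕ × ℕ => (cc lam p.1 n * s ^ p.1 / (p.1.factorial : ℝ)) *
        (cc lam p.2 n * t ^ p.2 / (p.2.factorial : ℝ))) :=
      summable_mul_of_summable_norm
        (f := fun m : ℕ => cc lam m n * s ^ m / (m.factorial : ℝ))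
        (g := fun m : ℕ => cc lam m n * t ^ m / (m.factorial : ℝ))
        (hQ n s hs).summable.norm (hQ n t ht).summable.norm
    have := ((hQ n s hs).mul (hQ n t ht) hs1).mul_left (hh lam n)
    exact hasSum_of_eq _ _ _ _ this (fun p => by simp only; ring) (by ring))
  -- sum over n first
  have hF' := (Equiv.prodComm (ℕ × ℕ) ℕ).hasSum_iff.mpr hF.hasSum
  have hB := hF'.prod_fiberwise (g := fun p : ℕ × ℕ => cc lam (p.1 + p.2) 0 *
      (s ^ p.1 / (p.1.factorial : ℝ) * (t ^ p.2 / (p.2.factorial : ℝ)))) (by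
    rintro ⟨a, b⟩
    exact (hasSum_cc lam a b).mul_right _)
  have hC := (Finset.HasAntidiagonal.sigmaAntidiagonalEquivProd (A := ℕ)).hasSum_iff.mpr hB
  have hD := hC.sigma (g := fun m : ℕ => cc lam m 0 * (s + t) ^ m / (m.factorial : ℝ)) (by
    intro m
    have := hasSum_fintype (fun c : Finset.HasAntidiagonal.antidiagonal m =>
      ((fun p : ℕ × ℕ => cc lam (p.1 + p.2) 0 *
      (s ^ p.1 / (p.1.factorial : ℝ) * (t ^ p.2 / (p.2.factorial : ℝ)))) ∘
        (Finset.HasAntidiagonal.sigmaAntidiagonalEquivProd (A := ℕ))) ⟨m, c⟩)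
    convert this using 1
    simp only [Function.comp, Finset.HasAntidiagonal.sigmaAntidiagonalEquivProd_apply]
    rw [Finset.sum_coe_sort (Finset.HasAntidiagonal.antidiagonal m) (fun p : ℕ × ℕ => cc lam (p.1 + p.2) 0 *
      (s ^ p.1 / (p.1.factorial : ℝ) * (t ^ p.2 / (p.2.factorial : ℝ)))),
      (Commute.all s t).add_pow', mul_div_assoc, Finset.sum_div, Finset.mul_sum]
    apply Finset.sum_congr rfl
    rintro ⟨a, b⟩ hab
    rw [Finset.HasAntidiagonal.mem_antidiagonal] at hab
    simp only at hab ⊢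
    subst hab
    rw [Nat.choose_symm_add, Nat.add_choose, nsmul_eq_mul, Nat.cast_div (Nat.factorial_mul_factorial_dvd_factorial_add a b)
      (by positivity)]
    push_cast
    field_simp)
  rw [(hQ 0 (s + t) hst).unique hD]
  exact hA

end params
end QU

/-- Addition formula for the functions attached to the continuous
q-ultraspherical polynomials. -/
theorem q_ultraspherical_addition (q β : ℝ)
    (hq0 : 0 < q) (hq1 : q < 1) (hβ1 : -1 < β) (hβ2 : β < 1) :
    (∀ (j : ℕ) (t : ℝ), t ≠ 0 → Summable (fun k : ℕ =>
      |((j : ℝ) + 2 * k + 1) * besselI (j + 2 * k + 1) t *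
        (∏ i ∈ Finset.range k, (β - q ^ (i + 1))) * qpoch (q ^ (j + 1)) q k /
        (qpoch q q k * qpoch (β * q ^ (j + 1)) q k)|)) ∧
    ∀ s t : ℝ, s ≠ 0 → t ≠ 0 → s + t ≠ 0 →
      Summable (fun n : ℕ =>
        |qpoch q q n * qpoch (β ^ 2) q n /
            (4 ^ n * qpoch β q n * qpoch (q * β) q n) *
          Qqultra q β n s * Qqultra q β n t|) ∧
      Qqultra q β 0 (s + t) =
        ∑' n : ℕ, qpoch q q n * qpoch (β ^ 2) q n /
            (4 ^ n * qpoch β q n * qpoch (q * β) q n) *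
          Qqultra q β n s * Qqultra q β n t := by
  have hb : |β| < 1 := abs_lt.mpr ⟨hβ1, hβ2⟩
  refine ⟨fun j t _ => QU.term_summable hq0 hq1 hb j t, fun s t hs ht hst => ?_⟩
  simp only [QU.hh_eq hq0 hq1 hb]
  have h := QU.addition hq0 hq1 hb s t hs ht hst
  exact ⟨h.summable.abs, h.tsum_eq.symm⟩
end

section
/- Let β > 1, x ∈ ℝ, c ∈ ℝ with c ≠ 0, and t, s ∈ ℝ, and define Q_n(u;β,c) = (u^n/n!) · e^u · ₁F₁(n - x; β + 2n; ((1-c)/c) u) for n ∈ ℕ. Then the series below converges absolutely and the addition formula for Meixner-polynomial moments holds: Q_0(t+s;β,c) = Σ_{n=0}^∞ [n! (-x)_n (β+x)_n (β-1)_n ((1-c)/c)^{2n} / ((β-1)_{2n} (β)_{2n})] · Q_n(t;β,c) · Q_n(s;β,c). -/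
/-- `Q_n(u;β,c) = (u^n/n!) e^u ₁F₁(n-x; β+2n; ((1-c)/c)u)`, the functions
attached to the Meixner polynomials viewed as moments. -/
noncomputable def QMeixner (β c x u : ℝ) (n : ℕ) : ℝ :=
  u ^ n / n.factorial * Real.exp u * oneF1 ((n : ℝ) - x) (β + 2 * n) ((1 - c) / c * u)

namespace MeixnerAux

lemma poch_zero (a : ℝ) : poch a 0 = 1 := by simp [poch]

lemma poch_succ (a : ℝ) (n : ℕ) : poch a (n + 1) = poch a n * (a + n) := by
  simp [poch, Finset.prod_range_succ]

lemma poch_add (a : ℝ) (m n : ℕ) : poch a (m + n) = poch a m * poch (a + m) n := by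
  induction n with
  | zero => simp [poch_zero]
  | succ n ih =>
    rw [← add_assoc, poch_succ, ih, poch_succ]
    push_cast
    ring

lemma poch_succ_left (a : ℝ) (n : ℕ) : poch a (n + 1) = a * poch (a + 1) n := by
  rw [add_comm n 1, poch_add, show (1 : ℕ) = 0 + 1 from rfl, poch_succ, poch_zero]
  simp

lemma poch_pos {a : ℝ} (ha : 0 < a) (n : ℕ) : 0 < poch a n :=
  Finset.prod_pos (fun i _ => by positivity)

/-- The factor depending on `n` only. -/
noncomputable def gg (a c : ℝ) (n : ℕ) : ℝ :=
  poch (c - a) n * poch c (2 * n) * poch (c - 1) n / (n.factorial * poch (c - 1) (2 * n))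

/-- The factor depending on `p`. -/
noncomputable def rr (c : ℝ) (p n : ℕ) : ℝ :=
  if n ≤ p then 1 / (poch c (p + n) * (p - n).factorial) else 0

/-- The full summand. -/
noncomputable def TT (a c : ℝ) (p q n : ℕ) : ℝ :=
  gg a c n * rr c p n * (poch (a + n) (q - n) / ((q - n).factorial * poch c (q + n)))

/-- The telescoping certificate. -/
noncomputable def GG (a c : ℝ) (p q m : ℕ) : ℝ :=
  -(m * (c + p + m - 1) / (c + 2 * m - 1)) * gg a c m * rr c p m *
    (poch (a + m - 1) (q + 1 - m) / ((q + 1 - m).factorial * poch c (q + m)))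

lemma rr_succ {c : ℝ} (hc : 1 < c) (p n : ℕ) :
    (c + p + n) * rr c p (n + 1) = (p - n) * rr c p n := by
  unfold rr
  rcases lt_trichotomy n p with h | h | h
  · obtain ⟨d, rfl⟩ := Nat.exists_eq_add_of_lt h
    rw [if_pos (by omega), if_pos (by omega), show n + d + 1 - (n + 1) = d by omega,
      show n + d + 1 - n = d + 1 by omega, ← add_assoc (n + d + 1) n 1, poch_succ c (n + d + 1 + n),
      Nat.factorial_succ]
    have h1 := poch_pos (show 0 < c by linarith) (n + d + 1 + n)
    have h2 : (0 : ℝ) < d.factorial := by positivity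
    have h3 : (0 : ℝ) < c + (n + d + 1) + n := by positivity
    push_cast
    field_simp
    ring
  · subst h
    simp
  · rw [if_neg (by omega), if_neg (by omega)]
    simp

lemma gg_succ {a c : ℝ} (hc : 1 < c) (n : ℕ) :
    (n + 1) * gg a c (n + 1) =
      gg a c n * (c - a + n) * (c + 2 * n + 1) * (c + n - 1) / (c + 2 * n - 1) := by
  unfold gg
  rw [show 2 * (n + 1) = 2 * n + 1 + 1 by ring]
  simp only [poch_succ, Nat.factorial_succ]
  have h1 := poch_pos (show 0 < c - 1 by linarith) (2 * n)
  have h2 : (0 : ℝ) < n.factorial := by positivity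
  have h3 : (0 : ℝ) < c + 2 * n - 1 := by
    have : (0 : ℝ) ≤ n := by positivity
    linarith
  have h4 : (0 : ℝ) < c - 1 + 2 * n := by linarith
  have h5 : (0 : ℝ) < c + 2 * n := by linarith
  have h6 : (0 : ℝ) < c - 1 + (2 * n + 1) := by linarith
  push_cast
  rw [show c - 1 + 2 * (n : ℝ) = c + 2 * n - 1 by ring,
    show c - 1 + (2 * (n : ℝ) + 1) = c + 2 * n by ring]
  field_simp
  ring

lemma telescope {a c : ℝ} (hc : 1 < c) (p q m : ℕ) (hm : m ≤ q) :
    (q + 1) * (c + p + q) * TT a c p (q + 1) m - (a + p + q) * TT a c p q m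
      = GG a c p q (m + 1) - GG a c p q m := by
  obtain ⟨d, rfl⟩ := Nat.exists_eq_add_of_le hm
  have hm0 : (0 : ℝ) ≤ m := by positivity
  have hd0 : (0 : ℝ) ≤ d := by positivity
  have hp0 : (0 : ℝ) ≤ p := by positivity
  have h1 : (0 : ℝ) < c + 2 * m - 1 := by linarith
  have h1' : (0 : ℝ) < c + 2 * m + 1 := by linarith
  have h2 : (0 : ℝ) < c + (m + d + m) := by linarith
  have hP := poch_pos (show 0 < c by linarith) (m + d + m)
  have hf : (0 : ℝ) < d.factorial := by positivity
  have e : GG a c p (m + d) (m + 1) = -(gg a c m * (c - a + m) * (c + m - 1) / (c + 2 * m - 1))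
      * ((p - m) * rr c p m) *
      (poch (a + m) d / (d.factorial * (poch c (m + d + m) * (c + (m + d + m))))) := by
    rw [← rr_succ hc]
    have := gg_succ (a := a) hc m
    unfold GG
    rw [show m + d + 1 - (m + 1) = d by omega, show m + d + (m + 1) = m + d + m + 1 by ring,
      poch_succ c]
    have e1 : -(((m + 1 : ℕ) : ℝ) * (c + p + (m + 1 : ℕ) - 1) / (c + 2 * (m + 1 : ℕ) - 1)) *
        gg a c (m + 1) = -((c + p + m) / (c + 2 * m + 1)) * ((m + 1) * gg a c (m + 1)) := by
      push_cast
      rw [show c + 2 * ((m : ℝ) + 1) - 1 = c + 2 * m + 1 by ring]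
      ring
    rw [e1, this]
    push_cast
    rw [show a + ((m : ℝ) + 1) - 1 = a + m by ring]
    field_simp
  rw [e]
  unfold TT GG
  rw [show m + d + 1 - m = d + 1 by omega, show m + d - m = d by omega,
    show m + d + 1 + m = m + d + m + 1 by ring, poch_succ c, poch_succ_left (a + m - 1),
    poch_succ (a + m), show a + (m : ℝ) - 1 + 1 = a + m by ring, Nat.factorial_succ]
  push_cast
  have hd1 : (0 : ℝ) < d + 1 := by linarith
  obtain ⟨D, hD⟩ : ∃ D, D = c + 2 * (m : ℝ) - 1 := ⟨_, rfl⟩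
  rw [← hD] at h1 ⊢
  have hD0 := h1.ne'
  field_simp
  rw [hD]
  ring

lemma finite_sum {a c : ℝ} (hc : 1 < c) (p q : ℕ) :
    ∑ n ∈ Finset.range (q + 1), TT a c p q n =
      poch (a + p) q / (poch c (p + q) * p.factorial * q.factorial) := by
  induction q with
  | zero => simp [TT, gg, rr, poch_zero]
  | succ q ih =>
    have hp0 : (0 : ℝ) ≤ p := by positivity
    have hq0 : (0 : ℝ) ≤ q := by positivity
    have tel : ∀ m ≤ q + 1, ∑ n ∈ Finset.range m,
        ((q + 1) * (c + p + q) * TT a c p (q + 1) n - (a + p + q) * TT a c p q n)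
        = GG a c p q m := by
      intro m
      induction m with
      | zero => intro _; simp [GG]
      | succ m ihm =>
        intro h
        rw [Finset.sum_range_succ, ihm (by omega), telescope hc p q m (by omega)]
        ring
    have h := tel (q + 1) le_rfl
    rw [Finset.sum_sub_distrib, ← Finset.mul_sum, ← Finset.mul_sum, ih] at h
    have hlast : (q + 1) * (c + p + q) * TT a c p (q + 1) (q + 1) = - GG a c p q (q + 1) := by
      unfold TT GG
      rw [show q + 1 + (q + 1) = q + (q + 1) + 1 by ring, poch_succ c (q + (q + 1))]
      have hP := poch_pos (show 0 < c by linarith) (q + (q + 1))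
      have h1 : (0 : ℝ) < c + 2 * (q + 1) - 1 := by linarith
      have h2 : (0 : ℝ) < c + (q + (q + 1)) := by linarith
      simp only [Nat.sub_self, poch_zero, Nat.factorial_zero]
      push_cast
      rw [show c + (q + ((q : ℝ) + 1)) = c + 2 * (q + 1) - 1 by ring]
      field_simp
      ring
    rw [Finset.sum_range_succ]
    have h1 : (0 : ℝ) < (q + 1) * (c + p + q) := by
      have : 0 < c + p + q := by linarith
      positivity
    have hP := poch_pos (show 0 < c by linarith) (p + q)
    have h3 : (0 : ℝ) < c + p + q := by linarith
    apply mul_left_cancel₀ h1.ne'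
    rw [mul_add, hlast, ← h, ← add_assoc p q 1, poch_succ c, poch_succ, Nat.factorial_succ]
    push_cast
    rw [show c + ((p : ℝ) + q) = c + p + q by ring]
    field_simp
    ring

/-- Coefficients of `₁F₁(a+n; c+2n; ·)`. -/
noncomputable def AA (a c : ℝ) (n i : ℕ) : ℝ :=
  poch (n + a) i / (poch (c + 2 * n) i * i.factorial)

/-- Coefficients of the addition formula. -/
noncomputable def CC (a c : ℝ) (n : ℕ) : ℝ :=
  poch a n * poch (c - a) n * poch (c - 1) n /
    (n.factorial * (poch (c - 1) (2 * n) * poch c (2 * n)))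

lemma CC_AA {a c : ℝ} (hc : 1 < c) (n i j : ℕ) :
    CC a c n * AA a c n i * AA a c n j = poch a (n + i) * TT a c (n + i) (n + j) n := by
  unfold CC AA TT gg rr
  have hP := poch_pos (show 0 < c by linarith) (2 * n)
  have hP' := poch_pos (show 0 < c - 1 by linarith) (2 * n)
  have h2 : 0 < c + 2 * n := by positivity
  have hi := poch_pos h2 i
  have hj := poch_pos h2 j
  rw [if_pos (by omega), show n + i - n = i by omega, show n + j - n = j by omega,
    show n + i + n = 2 * n + i by ring, show n + j + n = 2 * n + j by ring,
    poch_add c, poch_add c, poch_add a, add_comm (n : ℝ) a]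
  push_cast
  field_simp

lemma ratio_bound {u v M : ℝ} (hv : 0 < v) (h : ∀ k : ℕ, |u + k| ≤ M * (v + k)) (hM : 0 ≤ M)
    (n : ℕ) : |poch u n| ≤ M ^ n * poch v n := by
  induction n with
  | zero => simp [poch_zero]
  | succ n ih =>
    rw [poch_succ, poch_succ, abs_mul, pow_succ]
    calc |poch u n| * |u + n| ≤ (M ^ n * poch v n) * (M * (v + n)) := by
          gcongr
          · have := poch_pos hv n
            positivity
          · exact h n
      _ = _ := by ring

lemma AA_bound {a c : ℝ} (hc : 1 < c) (n i : ℕ) :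
    |AA a c n i| ≤ (|a| + 1) ^ i / i.factorial := by
  have h2 : 0 < c + 2 * (n : ℝ) := by positivity
  have hi := poch_pos h2 i
  unfold AA
  rw [abs_div, abs_of_pos (show 0 < poch (c + 2 * n) i * (i.factorial : ℝ) by positivity),
    div_le_div_iff₀ (by positivity) (by positivity)]
  have := ratio_bound (u := n + a) (v := c + 2 * n) (M := |a| + 1) h2 (by
    intro k
    have hn : (0 : ℝ) ≤ n := by positivity
    have hk : (0 : ℝ) ≤ k := by positivity
    have ha := abs_nonneg a
    rw [abs_le]
    constructor <;> nlinarith [neg_abs_le a, le_abs_self a, mul_nonneg ha hn, mul_nonneg ha hk])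
    (by positivity) i
  calc _ ≤ ((|a| + 1) ^ i * poch (c + 2 * n) i) * i.factorial := by gcongr
    _ = _ := by ring

lemma one_le_poch {v : ℝ} {n : ℕ} (h : 0 < n → 1 ≤ v) : 1 ≤ poch v n := by
  rcases Nat.eq_zero_or_pos n with rfl | hn
  · simp [poch_zero]
  · have hv := h hn
    clear h hn
    induction n with
    | zero => simp [poch_zero]
    | succ n ih =>
      rw [poch_succ]
      have : (0 : ℝ) ≤ n := by positivity
      nlinarith

lemma CC_bound {a c : ℝ} (hc : 1 < c) (n : ℕ) :
    |CC a c n| ≤ ((|a| + 1) ^ 2) ^ n / n.factorial := by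
  have ha := abs_nonneg a
  have hn : (0 : ℝ) ≤ n := by positivity
  have b1 := ratio_bound (u := a) (v := c) (M := |a| + 1) (by linarith) (by
    intro k
    have hk : (0 : ℝ) ≤ k := by positivity
    rw [abs_le]
    constructor <;> nlinarith [neg_abs_le a, le_abs_self a, mul_nonneg ha hk])
    (by positivity) n
  have b2 := ratio_bound (u := c - a) (v := c + n) (M := |a| + 1) (by linarith) (by
    intro k
    have hk : (0 : ℝ) ≤ k := by positivity
    rw [abs_le]
    constructor <;> nlinarith [neg_abs_le a, le_abs_self a, mul_nonneg ha hk, mul_nonneg ha hn])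
    (by positivity) n
  have b3 : 1 ≤ poch (c - 1 + n) n := one_le_poch (by
    intro h
    have : (1 : ℝ) ≤ n := by exact_mod_cast h
    linarith)
  have p1 := poch_pos (show 0 < c - 1 by linarith) n
  have p2 := poch_pos (show 0 < c by linarith) n
  have p3 := poch_pos (show 0 < c + n by linarith) n
  unfold CC
  rw [two_mul, poch_add (c - 1), poch_add c, abs_div, abs_mul, abs_mul, abs_of_pos p1,
    abs_of_pos (show 0 < (n.factorial : ℝ) *
      (poch (c - 1) n * poch (c - 1 + n) n * (poch c n * poch (c + n) n)) by positivity),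
    div_le_div_iff₀ (by positivity) (by positivity)]
  calc _ ≤ (((|a| + 1) ^ n * poch c n) * ((|a| + 1) ^ n * poch (c + n) n) * poch (c - 1) n)
        * n.factorial * 1 := by rw [mul_one]; gcongr
    _ ≤ (((|a| + 1) ^ n * poch c n) * ((|a| + 1) ^ n * poch (c + n) n) * poch (c - 1) n)
        * n.factorial * poch (c - 1 + n) n := by gcongr
    _ = _ := by
      rw [← pow_mul (|a| + 1) 2 n]
      ring

/-- The triple summand. -/
noncomputable def ff (a c X Y : ℝ) (w : ℕ × ℕ × ℕ) : ℝ :=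
  CC a c w.1 * (X * Y) ^ w.1 * ((AA a c w.1 w.2.1 * X ^ w.2.1) * (AA a c w.1 w.2.2 * Y ^ w.2.2))

lemma summable_ff {a c : ℝ} (hc : 1 < c) (X Y : ℝ) : Summable (ff a c X Y) := by
  have s (z : ℝ) := Real.summable_pow_div_factorial z
  set M := |a| + 1
  have hM : 0 ≤ M := by positivity
  have h2 := (s (M * |X|)).mul_of_nonneg (s (M * |Y|))
    (fun i => by positivity) (fun i => by positivity)
  have h3 := (s (M ^ 2 * |X * Y|)).mul_of_nonneg h2
    (fun i => by positivity) (fun i => by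
      simp only [Pi.zero_apply]
      positivity)
  refine Summable.of_norm_bounded h3 ?_
  rintro ⟨n, i, j⟩
  simp only [ff, Real.norm_eq_abs]
  rw [abs_mul, abs_mul, abs_mul, abs_mul, abs_mul, abs_pow, abs_pow, abs_pow]
  have e1 := CC_bound (a := a) hc n
  have e2 := AA_bound (a := a) hc n i
  have e3 := AA_bound (a := a) hc n j
  calc _ ≤ ((M ^ 2) ^ n / n.factorial) * |X * Y| ^ n *
        ((M ^ i / i.factorial * |X| ^ i) * (M ^ j / j.factorial * |Y| ^ j)) := by gcongr
    _ = _ := by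
      simp only [mul_pow]
      ring

lemma summable_AA {a c : ℝ} (hc : 1 < c) (n : ℕ) (X : ℝ) :
    Summable (fun i => AA a c n i * X ^ i) := by
  refine Summable.of_norm_bounded (Real.summable_pow_div_factorial ((|a| + 1) * |X|)) ?_
  intro i
  rw [Real.norm_eq_abs, abs_mul, abs_pow, mul_pow, mul_div_right_comm]
  gcongr
  exact AA_bound hc n i

lemma oneF1_eq (a c : ℝ) (n : ℕ) (X : ℝ) :
    oneF1 (n + a) (c + 2 * n) X = ∑' i, AA a c n i * X ^ i := by
  unfold oneF1 AA
  congr 1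
  ext i
  ring

/-- Same summand, indexed by the exponents of `X` and `Y`. -/
noncomputable def FF (a c X Y : ℝ) (w : (ℕ × ℕ) × ℕ) : ℝ :=
  if w.2 ≤ w.1.1 ∧ w.2 ≤ w.1.2 then
    poch a w.1.1 * TT a c w.1.1 w.1.2 w.2 * (X ^ w.1.1 * Y ^ w.1.2) else 0

def emb (w : ℕ × ℕ × ℕ) : (ℕ × ℕ) × ℕ := ((w.1 + w.2.1, w.1 + w.2.2), w.1)

lemma emb_inj : Function.Injective emb := by
  rintro ⟨n, i, j⟩ ⟨n2, i2, j2⟩ h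
  simp only [emb, Prod.mk.injEq] at h ⊢
  omega

lemma FF_emb {a c : ℝ} (hc : 1 < c) (X Y : ℝ) : FF a c X Y ∘ emb = ff a c X Y := by
  ext ⟨n, i, j⟩
  change FF a c X Y ((n + i, n + j), n) = _
  unfold FF ff
  rw [if_pos (by constructor <;> simp)]
  dsimp only
  rw [← CC_AA hc]
  ring

lemma FF_off (a c X Y : ℝ) : ∀ w ∉ Set.range emb, FF a c X Y w = 0 := by
  rintro ⟨⟨p, q⟩, n⟩ h
  unfold FF
  rw [if_neg]
  rintro ⟨h1, h2⟩
  dsimp only at h1 h2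
  refine h ⟨(n, p - n, q - n), ?_⟩
  exact Prod.ext (Prod.ext (Nat.add_sub_of_le h1) (Nat.add_sub_of_le h2)) rfl

lemma fiber_FF {a c : ℝ} (hc : 1 < c) (X Y : ℝ) (p q : ℕ) :
    HasSum (fun n => FF a c X Y ((p, q), n))
      (poch a (p + q) / (poch c (p + q) * p.factorial * q.factorial) * (X ^ p * Y ^ q)) := by
  have h : poch a (p + q) / (poch c (p + q) * p.factorial * q.factorial) * (X ^ p * Y ^ q)
      = ∑ n ∈ Finset.range (q + 1), FF a c X Y ((p, q), n) := by
    have : ∀ n ∈ Finset.range (q + 1), FF a c X Y ((p, q), n)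
        = poch a p * (X ^ p * Y ^ q) * TT a c p q n := by
      intro n hn
      have hn' : n ≤ q := by
        have := Finset.mem_range.mp hn
        omega
      unfold FF
      by_cases hp : n ≤ p
      · rw [if_pos ⟨hp, hn'⟩]
        ring
      · rw [if_neg (by tauto)]
        simp [TT, rr, hp]
    rw [Finset.sum_congr rfl this, ← Finset.mul_sum, finite_sum hc, poch_add a]
    ring
  rw [h]
  apply hasSum_sum_of_ne_finset_zero
  intro n hn
  have : ¬ n ≤ q := by
    rw [Finset.mem_range] at hn
    omega
  unfold FF
  rw [if_neg (by tauto)]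

lemma main_hasSum {a c : ℝ} (hc : 1 < c) (X Y : ℝ) :
    HasSum (fun n : ℕ => CC a c n * (X * Y) ^ n *
      (oneF1 (n + a) (c + 2 * n) X * oneF1 (n + a) (c + 2 * n) Y)) (oneF1 a c (X + Y)) := by
  have hs := summable_ff (a := a) hc X Y
  have H1 : HasSum (fun n : ℕ => CC a c n * (X * Y) ^ n *
      (oneF1 (n + a) (c + 2 * n) X * oneF1 (n + a) (c + 2 * n) Y)) (∑' w, ff a c X Y w) := by
    refine hs.hasSum.prod_fiberwise ?_
    intro n
    rw [oneF1_eq, oneF1_eq]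
    have hx := summable_AA (a := a) hc n X
    have hy := summable_AA (a := a) hc n Y
    exact (hx.hasSum.mul hy.hasSum (summable_mul_of_summable_norm hx.norm hy.norm)).mul_left _
  have H2 : HasSum (FF a c X Y) (∑' w, ff a c X Y w) := by
    rw [← emb_inj.hasSum_iff (FF_off a c X Y), FF_emb hc]
    exact hs.hasSum
  have H3 := H2.prod_fiberwise (fun w => fiber_FF hc X Y w.1 w.2)
  rw [← Finset.HasAntidiagonal.sigmaAntidiagonalEquivProd.hasSum_iff] at H3
  have H4 := H3.sigma (fun m => hasSum_fintype _)
  have key : ∑' w, ff a c X Y w = oneF1 a c (X + Y) := by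
    rw [← H4.tsum_eq]
    unfold oneF1
    congr 1
    ext m
    have hP := poch_pos (show 0 < c by linarith) m
    rw [(Commute.all X Y).add_pow', Finset.mul_sum, Finset.sum_div]
    rw [← Finset.sum_coe_sort (Finset.HasAntidiagonal.antidiagonal m)]
    apply Finset.sum_congr rfl
    rintro ⟨⟨p, q⟩, hw⟩ _
    have hpq : p + q = m := by simpa using hw
    subst hpq
    simp only [Function.comp, Finset.HasAntidiagonal.sigmaAntidiagonalEquivProd_apply]
    rw [nsmul_eq_mul, Nat.choose_symm_add, Nat.add_choose, Nat.cast_div (Nat.factorial_mul_factorial_dvd_factorial_add p q)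
      (by positivity)]
    push_cast
    field_simp
  rw [← key]
  exact H1

end MeixnerAux

/-- Addition formula for the Meixner-polynomial moment functions. -/
theorem meixner_moment_addition (β : ℝ) (hβ : 1 < β) (x c : ℝ) (hc : c ≠ 0)
    (t s : ℝ) :
    Summable (fun n : ℕ =>
      |(n.factorial : ℝ) * poch (-x) n * poch (β + x) n * poch (β - 1) n *
          ((1 - c) / c) ^ (2 * n) / (poch (β - 1) (2 * n) * poch β (2 * n)) *
        QMeixner β c x t n * QMeixner β c x s n|) ∧
    QMeixner β c x (t + s) 0 =
      ∑' n : ℕ, (n.factorial : ℝ) * poch (-x) n * poch (β + x) n *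
          poch (β - 1) n * ((1 - c) / c) ^ (2 * n) /
          (poch (β - 1) (2 * n) * poch β (2 * n)) *
        QMeixner β c x t n * QMeixner β c x s n := by
  have key : HasSum (fun n : ℕ => (n.factorial : ℝ) * poch (-x) n * poch (β + x) n *
          poch (β - 1) n * ((1 - c) / c) ^ (2 * n) /
          (poch (β - 1) (2 * n) * poch β (2 * n)) *
        QMeixner β c x t n * QMeixner β c x s n) (QMeixner β c x (t + s) 0) := by
    have h := (MeixnerAux.main_hasSum (a := -x) hβ ((1 - c) / c * t) ((1 - c) / c * s)).mul_left
      (Real.exp (t + s))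
    have e2 : QMeixner β c x (t + s) 0 = Real.exp (t + s) *
        oneF1 (-x) β ((1 - c) / c * t + (1 - c) / c * s) := by
      unfold QMeixner
      simp [mul_add]
    rw [e2]
    refine Eq.mp (congrArg (fun f => HasSum f _) (funext ?_)) h
    · intro n
      symm
      unfold QMeixner MeixnerAux.CC
      have hP := MeixnerAux.poch_pos (show 0 < β by linarith) (2 * n)
      have hP' := MeixnerAux.poch_pos (show 0 < β - 1 by linarith) (2 * n)
      rw [Real.exp_add, sub_neg_eq_add, ← sub_eq_add_neg]
      generalize (1 - c) / c = z
      generalize oneF1 _ _ (z * t) = F1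
      generalize oneF1 _ _ (z * s) = F2
      rw [mul_pow (z * t), mul_pow, mul_pow, pow_mul', sq]
      field_simp
  exact ⟨key.summable.abs, key.tsum_eq.symm⟩
end
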